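/- Let n ≥ 2 and let H = y² − x^{n+1} + H̄(x) be a hyperelliptic polynomial of Morse type, where H̄ ∈ ℂ[x] has degree ≤ n−1. Let c_1, …, c_n ∈ ℂ, not all zero, and set F(x,y) = Σ_{i=1}^{n} c_i x^{i−1} y (so that ω = F dx = Σ c_i ω_i is a combination of the Petrov forms). Let t_0 ∈ ℂ be a regular value of H, let U be an open connected neighbourhood of t_0 consisting of regular values of H, and let δ = (δ_x, δ_y) : U × ℝ → ℂ² be a continuous family of loops in the fibres of H: δ is continuous, δ(t, s+1) = δ(t, s), each s ↦ δ(t,s) is continuously differentiable with (t,s) ↦ ∂δ/∂s(t,s) continuous, and H(δ(t,s)) = t for all (t,s). Define I(t) = ∫₀¹ F(δ(t,s)) · ∂_s δ_x(t,s) ds. Then I is analytic in a neighbourhood of t_0, and if I is not identically zero near t_0, then its order of vanishing at t_0 satisfies ord_{t_0} I ≤ n−1 + n(n−1)/2. -/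

import Mathlib

open scoped BigOperators

/-- The order of vanishing at `t₀` of a function analytic near `t₀`. -/
noncomputable def ordAt (f : ℂ → ℂ) (t₀ : ℂ) : ℕ := sInf {k | iteratedDeriv k f t₀ ≠ 0}


section PetrovAlgebra
open Polynomial

/-- The nodal polynomial of `n` distinct roots of a polynomial of degree `n`. -/
theorem eq_C_mul_prod_of_roots {n : ℕ} {f : ℂ[X]} (hf : f.natDegree = n) (hf0 : f ≠ 0)
    {xs : Fin n → ℂ} (hxs : Function.Injective xs) (hroots : ∀ k, f.eval (xs k) = 0) :
    ∃ a : ℂ, a ≠ 0 ∧ f = C a * ∏ k, (X - C (xs k)) := by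
  have hdvd : (∏ k, (X - C (xs k))) ∣ f :=
    Finset.prod_dvd_of_coprime (fun i _ j _ hij => pairwise_coprime_X_sub_C hxs hij)
      fun i _ => dvd_iff_isRoot.2 (hroots i)
  obtain ⟨r, hr⟩ := hdvd
  have hr0 : r ≠ 0 := by rintro rfl; simp at hr; exact hf0 hr
  have hN : (∏ k, (X - C (xs k))) ≠ 0 := by intro h; rw [h, zero_mul] at hr; exact hf0 hr
  have hdeg : r.natDegree = 0 := by
    have h1 := natDegree_mul hN hr0
    rw [← hr, hf, natDegree_finsetProd_X_sub_C_eq_card] at h1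
    simpa using h1
  rw [natDegree_eq_zero] at hdeg
  obtain ⟨a, rfl⟩ := hdeg
  exact ⟨a, by simpa using hr0, by rw [hr, mul_comm]⟩

/-- The Picard–Fuchs relations in the Lagrange basis at the critical points. -/
theorem exists_picardFuchs_relations {n : ℕ} (hn : 1 ≤ n) {p : ℂ[X]} (hp : p.Monic)
    (hpdeg : p.natDegree = n + 1) {xs : Fin n → ℂ} (hxs : Function.Injective xs)
    (hroots : ∀ k, (derivative p).eval (xs k) = 0) :
    ∃ (e q : Fin n → ℂ[X]) (c : Fin n → Fin n → ℂ),
      (∀ k, e k * (p - C (p.eval (xs k))) = q k * derivative p) ∧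
      (∀ k, C (1 / 2) * e k + derivative (q k) = ∑ l, C (c k l) * e l) ∧
      (∀ k, c k k = 1) ∧
      ∀ g : Fin n → ℂ, ∃ h : Fin n → ℂ,
        ∑ i, C (g i) * X ^ (i : ℕ) = ∑ k, ∑ l, C (h k * c k l) * e l := by
  classical
  have hp'deg : (derivative p).natDegree = n := by
    rw [natDegree_derivative, hpdeg]; simp
  have hp'0 : derivative p ≠ 0 := by
    intro h; rw [h] at hp'deg; simp at hp'deg; omega
  have hp'coeff : (derivative p).coeff n = n + 1 := by
    rw [coeff_derivative, ← hpdeg, hp.coeff_natDegree, one_mul]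
  obtain ⟨a, ha, hp'⟩ := eq_C_mul_prod_of_roots hp'deg hp'0 hxs hroots
  have hp'' : ∀ k, (derivative (derivative p)).eval (xs k) ≠ 0 := by
    intro k
    rw [hp', derivative_mul, derivative_C, zero_mul, zero_add, eval_mul, eval_C]
    refine mul_ne_zero ha ?_
    have := Lagrange.eval_nodal_derivative_eval_node_eq (s := Finset.univ) (v := xs)
      (Finset.mem_univ k)
    rw [Lagrange.nodal] at this
    rw [this, Lagrange.eval_nodal]
    exact Finset.prod_ne_zero_iff.2 fun i hi => sub_ne_zero.2 fun h =>
      (Finset.mem_erase.1 hi).1 (hxs h).symm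
  have hinj : Set.InjOn xs (Finset.univ : Finset (Fin n)) := hxs.injOn
  set e : Fin n → ℂ[X] := fun k => Lagrange.basis Finset.univ xs k with he
  have heself : ∀ k, (e k).eval (xs k) = 1 := fun k =>
    Lagrange.eval_basis_self hinj (Finset.mem_univ k)
  have hene : ∀ k l, k ≠ l → (e k).eval (xs l) = 0 := fun k l hkl =>
    Lagrange.eval_basis_of_ne hkl (Finset.mem_univ l)
  have hedeg : ∀ k, (e k).natDegree = n - 1 := by
    intro k
    have := Lagrange.degree_basis hinj (Finset.mem_univ k)
    exact natDegree_eq_of_degree_eq_some (by simpa using this)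
  have hinterp : ∀ f : ℂ[X], f.natDegree < n → f = ∑ l, C (f.eval (xs l)) * e l := by
    intro f hf
    have hd : f.degree < (Finset.univ : Finset (Fin n)).card := by
      simpa using degree_le_natDegree.trans_lt (Nat.cast_lt.2 hf)
    have := Lagrange.eq_interpolate hinj hd
    rwa [Lagrange.interpolate_apply] at this
  have hq : ∀ k, ∃ q : ℂ[X], e k * (p - C (p.eval (xs k))) = q * derivative p := by
    intro k
    have : (∏ k, (X - C (xs k))) ∣ e k * (p - C (p.eval (xs k))) := by
      refine Finset.prod_dvd_of_coprime (fun i _ j _ hij => pairwise_coprime_X_sub_C hxs hij)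
        fun i _ => dvd_iff_isRoot.2 ?_
      rw [IsRoot.def, eval_mul]
      by_cases h : k = i
      · subst h; simp
      · rw [hene k i h, zero_mul]
    obtain ⟨s, hs⟩ := this
    refine ⟨s * C a⁻¹, ?_⟩
    rw [hs, hp']
    calc _ = s * 1 * ∏ k, (X - C (xs k)) := by ring
      _ = s * (C a⁻¹ * C a) * ∏ k, (X - C (xs k)) := by
        rw [← C_mul, inv_mul_cancel₀ ha, C_1]
      _ = _ := by ring
  choose q hq using hq
  have hqdeg : ∀ k, (q k).natDegree ≤ n := by
    intro k
    by_cases hq0 : q k = 0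
    · simp [hq0]
    have h1 := natDegree_mul hq0 hp'0
    rw [← hq k, hp'deg] at h1
    have h2 : (e k * (p - C (p.eval (xs k)))).natDegree ≤ (n - 1) + (n + 1) := by
      refine natDegree_mul_le_of_le (hedeg k).le ?_
      rw [natDegree_sub_C, hpdeg]
    omega
  set c : Fin n → Fin n → ℂ := fun k l => (C (1 / 2) * e k + derivative (q k)).eval (xs l) with hc
  have hce : ∀ k, C (1 / 2) * e k + derivative (q k) = ∑ l, C (c k l) * e l := by
    intro k
    refine hinterp _ ?_
    have h1 : (C (1 / 2) * e k).natDegree ≤ n - 1 :=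
      (natDegree_C_mul_le _ _).trans (hedeg k).le
    have h2 : (derivative (q k)).natDegree ≤ n - 1 :=
      (natDegree_derivative_le _).trans (Nat.sub_le_sub_right (hqdeg k) 1)
    have := natDegree_add_le_of_degree_le h1 h2
    omega
  refine ⟨e, q, c, hq, hce, ?_, ?_⟩
  · intro k
    have h1 := congrArg (fun f => (derivative f).eval (xs k)) (hq k)
    have h2 := congrArg (fun f => (derivative (derivative f)).eval (xs k)) (hq k)
    simp only [derivative_mul, derivative_sub, derivative_C, sub_zero, eval_add, eval_mul,
      eval_sub, eval_C, hroots k, sub_self, mul_zero, zero_add, heself, derivative_add,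
      add_zero] at h1 h2
    have hq0 : (q k).eval (xs k) = 0 := by
      rcases mul_eq_zero.1 h1.symm with h | h
      · exact h
      · exact absurd h (hp'' k)
    rw [hq0] at h2
    have h3 : (derivative (q k)).eval (xs k) = 1 / 2 := by
      have := hp'' k
      field_simp
      apply mul_right_cancel₀ this
      linear_combination -h2
    simp only [hc, eval_add, eval_mul, eval_C, heself, h3]
    norm_num
  · intro g
    -- the matrix `c` is invertible
    let L : (Fin n → ℂ) →ₗ[ℂ] (Fin n → ℂ) := Matrix.vecMulLinear (Matrix.of c)
    have hL : ∀ h l, L h l = ∑ k, h k * c k l := fun h l => rfl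
    have hLinj : Function.Injective L := by
      rw [← LinearMap.ker_eq_bot, LinearMap.ker_eq_bot']
      intro h hh
      set G : ℂ[X] := ∑ k, C (h k) * e k with hG
      set Q : ℂ[X] := ∑ k, C (h k) * q k with hQ
      set R : ℂ[X] := ∑ k, C (h k * p.eval (xs k)) * e k with hR
      have hGn : G.natDegree ≤ n - 1 := natDegree_sum_le_of_forall_le _ _ fun k _ =>
        (natDegree_C_mul_le _ _).trans (hedeg k).le
      have hRn : R.natDegree ≤ n - 1 := natDegree_sum_le_of_forall_le _ _ fun k _ =>
        (natDegree_C_mul_le _ _).trans (hedeg k).le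
      have hrel : G * p = Q * derivative p + R := by
        rw [hG, hQ, hR, Finset.sum_mul, Finset.sum_mul, ← Finset.sum_add_distrib]
        refine Finset.sum_congr rfl fun k _ => ?_
        rw [C_mul]
        linear_combination C (h k) * hq k
      have hzero : C (1 / 2) * G + derivative Q = 0 := by
        have : C (1 / 2) * G + derivative Q = ∑ l, C (L h l) * e l := by
          simp only [hG, hQ, Finset.mul_sum, ← Finset.sum_add_distrib, hL,
            map_sum, Finset.sum_mul]
          rw [Finset.sum_comm]
          refine Finset.sum_congr rfl fun k _ => ?_
          have := hce k
          simp only [derivative_mul, derivative_C, zero_mul, zero_add, C_mul, mul_assoc,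
            ← Finset.mul_sum]
          rw [← this]; ring
        rw [this, hh]; simp
      have hG0 : G = 0 := by
        by_contra hG0
        set d := G.natDegree with hd
        have hQ1 : Q.natDegree ≤ d + 1 := by
          have h1 : derivative Q = C (-1 / 2) * G := by
            rw [show (-1 / 2 : ℂ) = -(1 / 2) by ring, C_neg]
            linear_combination hzero
          have h2 : (derivative Q).natDegree ≤ d := by
            rw [h1]; exact natDegree_C_mul_le _ _
          rw [natDegree_derivative] at h2
          omega
        have h1 := congrArg (fun f => f.coeff (d + (n + 1))) hrel
        have h2 := congrArg (fun f => f.coeff d) hzero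
        have h3 : R.coeff (d + (n + 1)) = 0 := coeff_eq_zero_of_natDegree_lt (by omega)
        simp only [coeff_add, h3, add_zero] at h1
        rw [coeff_mul_add_eq_of_natDegree_le le_rfl hpdeg.le,
          show d + (n + 1) = (d + 1) + n by ring,
          coeff_mul_add_eq_of_natDegree_le hQ1 hp'deg.le, hp'coeff, ← hpdeg, hp.coeff_natDegree]
          at h1
        simp only [coeff_add, coeff_C_mul, coeff_derivative, coeff_zero] at h2
        have h4 : G.coeff d * ((n + 1) / 2 + (d + 1)) = 0 := by
          linear_combination (n + 1 : ℂ) * h2 + (d + 1 : ℂ) * h1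
        rcases mul_eq_zero.1 h4 with h | h
        · exact hG0 (leadingCoeff_eq_zero.1 h)
        · have : ((n + 1 + 2 * (d + 1) : ℕ) : ℂ) = 0 := by
            push_cast; linear_combination 2 * h
          exact absurd (Nat.cast_eq_zero.1 this) (by omega)
      funext l
      have h1 := congrArg (fun f => f.eval (xs l)) hG0
      simp only [hG, eval_finsetSum, eval_mul, eval_C, eval_zero] at h1
      rw [Finset.sum_eq_single l (fun k _ hk => by rw [hene k l hk, mul_zero]) (by simp),
        heself, mul_one] at h1
      exact h1
    obtain ⟨h, hh⟩ := LinearMap.injective_iff_surjective.1 hLinj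
      fun l => (∑ i, C (g i) * X ^ (i : ℕ)).eval (xs l)
    refine ⟨h, ?_⟩
    rw [hinterp (∑ i, C (g i) * X ^ (i : ℕ)) ?_, Finset.sum_comm]
    · refine Finset.sum_congr rfl fun l _ => ?_
      rw [← Finset.sum_mul, ← map_sum, ← hL, hh]
    · have : (∑ i : Fin n, C (g i) * X ^ (i : ℕ)).natDegree ≤ n - 1 :=
        natDegree_sum_le_of_forall_le _ _ fun i _ =>
          (natDegree_C_mul_X_pow_le _ _).trans (by omega)
      omega

end PetrovAlgebra

section FormalSections
open PowerSeries

/-- A formal solution of `X w' + w_k b + X w G = 0` with `w(0) = b`, when `b_k = 0`. -/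
theorem exists_formal_flat_section {n : ℕ} (k : Fin n) (b : Fin n → ℂ) (hb : b k = 0)
    (G : Fin n → Fin n → ℂ⟦X⟧) :
    ∃ w : Fin n → ℂ⟦X⟧, (∀ l, constantCoeff (w l) = b l) ∧
      ∀ l, X * d⁄dX ℂ (w l) + w k * C (b l) + X * ∑ i, w i * G i l = 0 := by
  classical
  -- the contribution of the lower coefficients
  let S : ℕ → (ℕ → Fin n → ℂ) → Fin n → ℂ := fun m v l =>
    ∑ i, ∑ x ∈ Finset.HasAntidiagonal.antidiagonal m, v x.1 i * coeff x.2 (G i l)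
  let Φ : (m : ℕ) → (∀ i < m, Fin n → ℂ) → Fin n → ℂ := fun m v =>
    match m with
    | 0 => b
    | m + 1 => fun l =>
      let r := S m fun i => if h : i < m + 1 then v i h else 0
      (-r l + r k / (m + 1) * b l) / (m + 1)
  have hfix : ∃ v : ℕ → Fin n → ℂ, ∀ m, v m = Φ m fun i _ => v i :=
    ⟨WellFounded.fix (C := fun _ => Fin n → ℂ) Nat.lt_wfRel.wf Φ,
      fun m => WellFounded.fix_eq (C := fun _ => Fin n → ℂ) Nat.lt_wfRel.wf Φ m⟩
  obtain ⟨v, hv⟩ := hfix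
  have hv0 : v 0 = b := hv 0
  have hvs : ∀ m l, v (m + 1) l = (-S m v l + S m v k / (m + 1) * b l) / (m + 1) := by
    intro m l
    have hS : ∀ l, S m (fun i => if h : i < m + 1 then v i else 0) l = S m v l := by
      intro l
      refine Finset.sum_congr rfl fun i _ => Finset.sum_congr rfl fun x hx => ?_
      have : x.1 < m + 1 := by
        have := Finset.HasAntidiagonal.mem_antidiagonal.1 hx
        omega
      simp [this]
    rw [hv (m + 1)]
    simp only [Φ]
    rw [hS, hS]
  refine ⟨fun l => PowerSeries.mk fun m => v m l, fun l => ?_, fun l => ?_⟩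
  · rw [← coeff_zero_eq_constantCoeff_apply, coeff_mk, hv0]
  · ext m
    cases m with
    | zero => simp [hv0, hb]
    | succ m =>
      have hm : (m + 1 : ℂ) ≠ 0 := Nat.cast_add_one_ne_zero m
      simp only [map_add, coeff_succ_X_mul, coeff_derivative, coeff_mk, coeff_mul_C, map_sum,
        map_zero]
      have h1 : ∑ i, coeff m ((PowerSeries.mk fun m => v m i) * G i l) = S m v l := by
        refine Finset.sum_congr rfl fun i _ => ?_
        rw [coeff_mul]; simp
      rw [h1, hvs, hvs, hb]
      field_simp
      ring

/-- A determinant with rows `X ^ e j • a j + φ j • w` vanishes to order `∑ e j - E`. -/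
theorem dvd_mul_det_of_rows {R : Type*} [CommRing R] {m : ℕ} (x : R) (e : Fin m → ℕ) (E : ℕ)
    (hE : ∀ j, e j ≤ E) (a : Fin m → Fin m → R) (φ w : Fin m → R) :
    x ^ (∑ j, e j) ∣ x ^ E * (Matrix.of fun j c => x ^ e j * a j c + φ j * w c).det := by
  let row : Matrix Unit (Fin m) R := Matrix.of fun _ c => w c
  let col : Matrix (Fin m) Unit R := Matrix.of fun j _ => - φ j
  let col' : Matrix (Fin m) Unit R := Matrix.of fun j _ => - (x ^ (E - e j) * φ j)
  let D : Matrix (Fin m) (Fin m) R := Matrix.diagonal fun j => x ^ e j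
  let A : Matrix (Fin m) (Fin m) R := Matrix.of a
  have h1 : (Matrix.of fun j c => x ^ e j * a j c + φ j * w c) = D * A - col * row := by
    ext j c
    rw [Matrix.sub_apply, Matrix.diagonal_mul]
    simp [A, col, row, Matrix.mul_apply]
  have h2 : Matrix.fromBlocks 1 row col (D * A)
        * Matrix.fromBlocks (x ^ E • (1 : Matrix Unit Unit R)) 0 0 (1 : Matrix (Fin m) (Fin m) R)
      = Matrix.fromBlocks (1 : Matrix Unit Unit R) 0 0 D
        * Matrix.fromBlocks (x ^ E • (1 : Matrix Unit Unit R)) row col' A := by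
    rw [Matrix.fromBlocks_multiply, Matrix.fromBlocks_multiply]
    congr 1
    · simp
    · simp
    · ext j c
      have : x ^ E = x ^ e j * x ^ (E - e j) := by rw [← pow_add, Nat.add_sub_cancel' (hE j)]
      simp [D, col, col', Matrix.diagonal_mul, this, mul_assoc]
    · simp
  have h3 := congrArg Matrix.det h2
  rw [Matrix.det_mul, Matrix.det_mul, Matrix.det_fromBlocks_one₁₁, ← h1,
    Matrix.det_fromBlocks_zero₂₁, Matrix.det_fromBlocks_zero₂₁, Matrix.det_diagonal,
    Finset.prod_pow_eq_pow_sum] at h3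
  simp only [Matrix.det_smul, Matrix.det_one, Fintype.card_unit, pow_one, mul_one, one_mul] at h3
  rw [mul_comm, h3]
  exact dvd_mul_right _ _

end FormalSections

section OkuboRows
open Polynomial

variable {n : ℕ}

/-- The polynomial with simple roots `T k`. -/
noncomputable def rootProd (T : Fin n → ℂ) : ℂ[X] := ∏ k, (X - C (T k))

/-- The polynomial with simple roots `T i`, `i ≠ k`. -/
noncomputable def rootProdErase (T : Fin n → ℂ) (k : Fin n) : ℂ[X] :=
  ∏ i ∈ Finset.univ.erase k, (X - C (T i))

/-- The dual connection of the system `(t - T k) J' k = ∑ l, B k l * J l`, multiplied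
by `rootProd T`. -/
noncomputable def okuboOp (T : Fin n → ℂ) (B : Fin n → Fin n → ℂ) (u : Fin n → ℂ[X]) :
    Fin n → ℂ[X] :=
  fun l => rootProd T * derivative (u l) + ∑ i, u i * (rootProdErase T i * C (B i l))

/-- The rows expressing the derivatives of `∑ k, h k * (t - T k) * J k` through `J`, with
denominators cleared. -/
noncomputable def okuboRow (T : Fin n → ℂ) (B : Fin n → Fin n → ℂ) (h : Fin n → ℂ) :
    ℕ → Fin n → ℂ[X]
  | 0 => fun l => C (h l) * (X - C (T l))
  | 1 => fun l => C (h l + ∑ k, h k * B k l)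
  | j + 2 => fun l => okuboOp T B (okuboRow T B h (j + 1)) l
      - (j : ℂ[X]) * derivative (rootProd T) * okuboRow T B h (j + 1) l

theorem okuboRow_add_two (T : Fin n → ℂ) (B : Fin n → Fin n → ℂ) (h : Fin n → ℂ) (j : ℕ)
    (l : Fin n) :
    okuboRow T B h (j + 2) l = rootProd T * derivative (okuboRow T B h (j + 1) l)
      + ∑ i, okuboRow T B h (j + 1) i * (rootProdErase T i * C (B i l))
      - (j : ℂ[X]) * derivative (rootProd T) * okuboRow T B h (j + 1) l :=
  rfl

/-- A minor of the first `m` rows. -/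
noncomputable def okuboMinor (T : Fin n → ℂ) (B : Fin n → Fin n → ℂ) (h : Fin n → ℂ) {m : ℕ}
    (σ : Fin m → Fin n) : Matrix (Fin m) (Fin m) ℂ[X] :=
  Matrix.of fun j c => okuboRow T B h j (σ c)

theorem rootProd_eq_mul (T : Fin n → ℂ) (k : Fin n) :
    rootProd T = (X - C (T k)) * rootProdErase T k :=
  (Finset.mul_prod_erase _ _ (Finset.mem_univ k)).symm

theorem exists_rootProdErase_eq_mul (T : Fin n → ℂ) {i k : Fin n} (hik : i ≠ k) :
    ∃ R, rootProdErase T i = (X - C (T k)) * R :=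
  ⟨_, (Finset.mul_prod_erase _ _ (Finset.mem_erase.2 ⟨hik.symm, Finset.mem_univ k⟩)).symm⟩

/-- Expansion of a polynomial at `a` as a power series. -/
noncomputable def expandAt (a : ℂ) : ℂ[X] →+* PowerSeries ℂ :=
  (coeToPowerSeries.ringHom).comp (compRingHom (X + C a))

theorem expandAt_C (a b : ℂ) : expandAt a (C b) = PowerSeries.C b := by
  simp [expandAt]

theorem expandAt_X_sub_C (a b : ℂ) :
    expandAt a (X - C b) = PowerSeries.X + PowerSeries.C (a - b) := by
  simp only [expandAt, RingHom.comp_apply, coe_compRingHom_apply, coeToPowerSeries.ringHom_apply,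
    X_comp, C_comp, coe_add, coe_X, coe_C, map_sub]
  ring

theorem expandAt_derivative (a : ℂ) (f : ℂ[X]) :
    expandAt a (derivative f) = PowerSeries.derivative ℂ (expandAt a f) := by
  simp only [expandAt, RingHom.comp_apply, coe_compRingHom_apply, coeToPowerSeries.ringHom_apply,
    PowerSeries.derivative_coe]
  congr 1
  rw [derivative_comp]; simp

theorem X_sub_C_pow_dvd_iff_expandAt (a : ℂ) (f : ℂ[X]) (N : ℕ) :
    (X - C a) ^ N ∣ f ↔ PowerSeries.X ^ N ∣ expandAt a f := by
  rw [X_sub_C_pow_dvd_iff, X_pow_dvd_iff, PowerSeries.X_pow_dvd_iff]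
  simp [expandAt]

theorem constantCoeff_expandAt (a : ℂ) (f : ℂ[X]) :
    PowerSeries.constantCoeff (expandAt a f) = f.eval a := by
  simp [expandAt, ← PowerSeries.coeff_zero_eq_constantCoeff_apply, coeff_zero_eq_eval_zero]

theorem eval_rootProdErase_ne_zero {T : Fin n → ℂ} (hT : Function.Injective T) (k : Fin n) :
    (rootProdErase T k).eval (T k) ≠ 0 := by
  rw [rootProdErase, eval_prod]
  refine Finset.prod_ne_zero_iff.2 fun i hi => ?_
  simpa [sub_eq_zero] using fun h => (Finset.mem_erase.1 hi).1 (hT h).symm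

/-- Near a singular point the rows are, up to a multiple of one flat section, divisible
by a high power of the local coordinate. -/
theorem exists_expandAt_okuboRow {T : Fin n → ℂ} (hT : Function.Injective T)
    {B : Fin n → Fin n → ℂ} (hB : ∀ k, B k k = 0) (h : Fin n → ℂ) (k : Fin n) :
    ∃ w : Fin n → PowerSeries ℂ, ∀ j : ℕ, ∃ (a : Fin n → PowerSeries ℂ) (φ : PowerSeries ℂ),
      ∀ l, expandAt (T k) (okuboRow T B h j l) = PowerSeries.X ^ (j - 1) * a l + φ * w l := by
  classical
  have hR : ∀ i, ∃ R : ℂ[X], i ≠ k → rootProdErase T i = (X - C (T k)) * R := by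
    intro i
    by_cases hik : i = k
    · exact ⟨0, fun h => absurd hik h⟩
    · obtain ⟨R, hR⟩ := exists_rootProdErase_eq_mul T hik
      exact ⟨R, fun _ => hR⟩
  choose R hR using hR
  set τ := expandAt (T k) with hτ
  set Q : PowerSeries ℂ := τ (rootProdErase T k) with hQ
  have hQ0 : PowerSeries.constantCoeff Q ≠ 0 := by
    rw [hQ, hτ, constantCoeff_expandAt]; exact eval_rootProdErase_ne_zero hT k
  set S : Fin n → PowerSeries ℂ := fun i => if i = k then 0 else τ (R i) with hS
  have hX : τ (X - C (T k)) = PowerSeries.X := by simp [hτ, expandAt_X_sub_C]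
  have hP : τ (rootProd T) = PowerSeries.X * Q := by rw [rootProd_eq_mul T k, map_mul, hX]
  obtain ⟨w, hw0, hw⟩ := exists_formal_flat_section k (B k) (hB k)
    fun i l => Q⁻¹ * (S i * PowerSeries.C (B i l))
  have hQQ : Q * Q⁻¹ = 1 := PowerSeries.mul_inv_cancel Q hQ0
  have hw' : ∀ l, PowerSeries.X * Q * PowerSeries.derivative ℂ (w l)
      + w k * Q * PowerSeries.C (B k l)
      + PowerSeries.X * ∑ i, w i * (S i * PowerSeries.C (B i l)) = 0 := by
    intro l
    have h1 : Q * ∑ i, w i * (Q⁻¹ * (S i * PowerSeries.C (B i l)))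
        = ∑ i, w i * (S i * PowerSeries.C (B i l)) := by
      rw [Finset.mul_sum]
      refine Finset.sum_congr rfl fun i _ => ?_
      linear_combination (w i * (S i * PowerSeries.C (B i l))) * hQQ
    linear_combination Q * hw l - PowerSeries.X * h1
  have hz : ∀ l, ∃ z, w l = PowerSeries.C (B k l) + PowerSeries.X * z := by
    intro l
    have : PowerSeries.X ∣ w l - PowerSeries.C (B k l) := by
      rw [PowerSeries.X_dvd_iff]; simp [hw0]
    obtain ⟨z, hz⟩ := this
    exact ⟨z, by rw [← hz]; ring⟩
  choose z hz using hz
  have hsum : ∀ (v : Fin n → ℂ[X]) (l : Fin n),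
      τ (∑ i, v i * (rootProdErase T i * C (B i l))) =
        τ (v k) * Q * PowerSeries.C (B k l)
          + PowerSeries.X * ∑ i, τ (v i) * (S i * PowerSeries.C (B i l)) := by
    intro v l
    rw [map_sum, ← Finset.add_sum_erase _ _ (Finset.mem_univ k), Finset.mul_sum,
      ← Finset.add_sum_erase (Finset.univ : Finset (Fin n))
        (fun i => PowerSeries.X * (τ (v i) * (S i * PowerSeries.C (B i l)))) (Finset.mem_univ k)]
    rw [show S k = 0 by simp [hS]]
    simp only [zero_mul, mul_zero, zero_add]
    congr 1
    · rw [map_mul, map_mul, hτ, expandAt_C, ← hτ]; ring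
    · refine Finset.sum_congr rfl fun i hi => ?_
      have hik := (Finset.mem_erase.1 hi).1
      rw [map_mul, map_mul, hR i hik, map_mul, hX, hτ, expandAt_C, ← hτ]
      simp only [hS, if_neg hik]; ring
  refine ⟨w, fun j => ?_⟩
  match j with
  | 0 => exact ⟨fun l => τ (okuboRow T B h 0 l), 0, fun l => by simp⟩
  | j + 1 =>
    induction j with
    | zero => exact ⟨fun l => τ (okuboRow T B h 1 l), 0, fun l => by simp⟩
    | succ j ih =>
      obtain ⟨a, φ, ha⟩ := ih
      simp only [Nat.add_sub_cancel] at ha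
      refine ⟨fun l => Q * PowerSeries.derivative ℂ (a l) - a k * Q * z l
          + ∑ i, a i * (S i * PowerSeries.C (B i l)) -
          (j : PowerSeries ℂ) * PowerSeries.derivative ℂ Q * a l,
        PowerSeries.X * Q * PowerSeries.derivative ℂ φ + PowerSeries.X ^ j * a k * Q
          - (j : PowerSeries ℂ) * (Q + PowerSeries.X * PowerSeries.derivative ℂ Q) * φ, fun l => ?_⟩
      have hd : τ (derivative (okuboRow T B h (j + 1) l)) =
          (j : PowerSeries ℂ) * PowerSeries.X ^ (j - 1) * a l +
            PowerSeries.X ^ j * PowerSeries.derivative ℂ (a l)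
          + PowerSeries.derivative ℂ φ * w l + φ * PowerSeries.derivative ℂ (w l) := by
        rw [hτ, expandAt_derivative, ← hτ, ha l]
        simp only [map_add, Derivation.leibniz, PowerSeries.derivative_pow,
          PowerSeries.derivative_X, smul_eq_mul]
        ring
      have hdP : τ (derivative (rootProd T)) = Q + PowerSeries.X * PowerSeries.derivative ℂ Q := by
        rw [hτ, expandAt_derivative, ← hτ, hP]
        simp only [Derivation.leibniz, PowerSeries.derivative_X, smul_eq_mul]
        ring
      have hs : ∑ i, τ (okuboRow T B h (j + 1) i) * (S i * PowerSeries.C (B i l)) =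
          PowerSeries.X ^ j * ∑ i, a i * (S i * PowerSeries.C (B i l))
          + φ * ∑ i, w i * (S i * PowerSeries.C (B i l)) := by
        rw [Finset.mul_sum, Finset.mul_sum, ← Finset.sum_add_distrib]
        refine Finset.sum_congr rfl fun i _ => ?_
        rw [ha i]; ring
      have hpow : (j : PowerSeries ℂ) * PowerSeries.X ^ (j - 1) * PowerSeries.X
          = (j : PowerSeries ℂ) * PowerSeries.X ^ j := by
        cases j with
        | zero => simp only [Nat.cast_zero, zero_mul]
        | succ j => rw [Nat.add_sub_cancel, mul_assoc, ← pow_succ]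
      rw [okuboRow_add_two, map_sub, map_add, map_mul, map_mul, map_mul, hd, hdP, hP, hsum, hs,
        ha l, ha k, map_natCast, Nat.add_sub_cancel]
      linear_combination φ * hw' l + Q * a l * hpow - PowerSeries.X ^ j * a k * Q * hz l

theorem rootProd_pow_dvd_det_okuboMinor {T : Fin n → ℂ} (hT : Function.Injective T)
    {B : Fin n → Fin n → ℂ} (hB : ∀ k, B k k = 0) (h : Fin n → ℂ) {m : ℕ} (σ : Fin m → Fin n) :
    rootProd T ^ ((∑ j : Fin m, ((j : ℕ) - 1)) - (m - 2)) ∣ (okuboMinor T B h σ).det := by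
  rw [rootProd, ← Finset.prod_pow]
  refine Finset.prod_dvd_of_coprime
    (fun i _ j _ hij => (pairwise_coprime_X_sub_C hT hij).pow) fun k _ => ?_
  rw [X_sub_C_pow_dvd_iff_expandAt, RingHom.map_det]
  obtain ⟨w, hw⟩ := exists_expandAt_okuboRow hT hB h k
  choose a φ hw using hw
  have h1 := dvd_mul_det_of_rows (PowerSeries.X : PowerSeries ℂ) (fun j : Fin m => (j : ℕ) - 1)
    (m - 2) (fun j => by have := j.2; omega) (fun j c => a j (σ c)) (fun j => φ j)
    fun c => w (σ c)
  have h2 : (expandAt (T k)).mapMatrix (okuboMinor T B h σ) = Matrix.of fun j c : Fin m =>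
      PowerSeries.X ^ ((j : ℕ) - 1) * a j (σ c) + φ j * w (σ c) := by
    ext1 j c
    exact hw j (σ c)
  rw [h2]
  by_cases hm : (m - 2) ≤ ∑ j : Fin m, ((j : ℕ) - 1)
  · rw [← Nat.add_sub_cancel' hm, pow_add] at h1
    exact (mul_dvd_mul_iff_left (pow_ne_zero _ PowerSeries.X_ne_zero)).1 h1
  · rw [Nat.sub_eq_zero_of_le (by omega), pow_zero]
    exact one_dvd _

theorem natDegree_rootProd (T : Fin n → ℂ) : (rootProd T).natDegree = n := by
  simp [rootProd, natDegree_finsetProd_X_sub_C_eq_card]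

theorem rootProd_ne_zero (T : Fin n → ℂ) : rootProd T ≠ 0 :=
  (monic_prod_of_monic _ _ fun _ _ => monic_X_sub_C _).ne_zero

theorem natDegree_rootProdErase (T : Fin n → ℂ) (k : Fin n) :
    (rootProdErase T k).natDegree = n - 1 := by
  simp [rootProdErase, natDegree_finsetProd_X_sub_C_eq_card]

theorem natDegree_okuboRow_le (T : Fin n → ℂ) (B : Fin n → Fin n → ℂ) (h : Fin n → ℂ) (j : ℕ)
    (l : Fin n) :
    (okuboRow T B h j l).natDegree ≤ if j = 0 then 1 else (j - 1) * (n - 1) := by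
  match j with
  | 0 =>
    rw [if_pos rfl, okuboRow]
    exact (natDegree_C_mul_le _ _).trans (natDegree_X_sub_C _).le
  | j + 1 =>
    rw [if_neg j.succ_ne_zero, Nat.add_sub_cancel]
    have hn : 0 < n := l.pos
    induction j generalizing l with
    | zero => simp only [okuboRow, natDegree_C, zero_mul, le_refl]
    | succ j ih =>
      rw [okuboRow_add_two]
      have hmul : (j + 1) * (n - 1) = j * (n - 1) + (n - 1) := by ring
      refine (natDegree_sub_le _ _).trans (max_le (natDegree_add_le_of_degree_le ?_ ?_) ?_)
      · by_cases h0 : derivative (okuboRow T B h (j + 1) l) = 0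
        · rw [h0]; simp
        have h1 := natDegree_derivative (okuboRow T B h (j + 1) l)
        have h2 : 0 < (okuboRow T B h (j + 1) l).natDegree := by
          refine Nat.pos_of_ne_zero fun h => h0 ?_
          rw [natDegree_eq_zero] at h
          obtain ⟨x, hx⟩ := h
          rw [← hx, derivative_C]
        have h3 := ih l
        refine natDegree_mul_le.trans ?_
        rw [natDegree_rootProd]; omega
      · refine natDegree_sum_le_of_forall_le _ _ fun i _ => ?_
        rw [hmul]
        refine natDegree_mul_le_of_le (ih i) ((natDegree_mul_C_le _ _).trans ?_)
        rw [natDegree_rootProdErase]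
      · rw [mul_assoc, ← nsmul_eq_mul]
        refine (natDegree_smul_le _ _).trans ?_
        rw [hmul, add_comm (j * (n - 1))]
        refine natDegree_mul_le_of_le ?_ (ih l)
        rw [natDegree_derivative, natDegree_rootProd]

theorem natDegree_det_le_sum {m : ℕ} (M : Matrix (Fin m) (Fin m) ℂ[X]) (d : Fin m → ℕ)
    (hM : ∀ j c, (M j c).natDegree ≤ d j) : M.det.natDegree ≤ ∑ j, d j := by
  rw [Matrix.det_apply]
  refine natDegree_sum_le_of_forall_le _ _ fun τ _ => ?_
  refine (natDegree_smul_le _ _).trans ((natDegree_prod_le _ _).trans ?_)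
  rw [← Equiv.sum_comp τ d]
  exact Finset.sum_le_sum fun c _ => hM _ _

theorem sum_fin_sub_one (m : ℕ) : 2 * ∑ j : Fin m, ((j : ℕ) - 1) = (m - 1) * (m - 2) := by
  rw [Fin.sum_univ_eq_sum_range (fun j => j - 1)]
  cases m with
  | zero => simp
  | succ m =>
    rw [Finset.sum_range_succ']
    simp only [Nat.add_sub_cancel, Nat.zero_sub, add_zero]
    rw [mul_comm, Finset.sum_range_id_mul_two]
    rfl

/-- The number of zeros of a nonzero minor at a regular point. -/
theorem rootMultiplicity_det_okuboMinor_le {T : Fin n → ℂ} (hT : Function.Injective T)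
    {B : Fin n → Fin n → ℂ} (hB : ∀ k, B k k = 0) (h : Fin n → ℂ) (hn : 2 ≤ n) {m : ℕ}
    (hm : 1 ≤ m) (hmn : m ≤ n) (σ : Fin m → Fin n) (hσ : (okuboMinor T B h σ).det ≠ 0) {t₀ : ℂ}
    (ht₀ : ∀ k, t₀ ≠ T k) :
    m + (okuboMinor T B h σ).det.rootMultiplicity t₀ ≤ n + n * (n - 1) / 2 := by
  set D := (okuboMinor T B h σ).det with hD
  set μ := D.rootMultiplicity t₀ with hμ
  set s := ∑ j : Fin m, ((j : ℕ) - 1) with hs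
  have h1 : (X - C t₀) ^ μ * rootProd T ^ (s - (m - 2)) ∣ D := by
    refine IsCoprime.mul_dvd ?_ (pow_rootMultiplicity_dvd D t₀)
      (rootProd_pow_dvd_det_okuboMinor hT hB h σ)
    refine IsCoprime.pow (IsCoprime.prod_right fun k _ => ?_)
    exact isCoprime_X_sub_C_of_isUnit_sub (sub_ne_zero.2 (ht₀ k)).isUnit
  have h2 := natDegree_le_of_dvd h1 hσ
  have h3 : D.natDegree ≤ 1 + s * (n - 1) := by
    refine (natDegree_det_le_sum _ (fun j : Fin m => if (j : ℕ) = 0 then 1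
      else ((j : ℕ) - 1) * (n - 1)) fun j c => natDegree_okuboRow_le T B h j (σ c)).trans ?_
    obtain ⟨m, rfl⟩ : ∃ m', m = m' + 1 := ⟨m - 1, by omega⟩
    rw [hs, Finset.sum_mul, Fin.sum_univ_succ, Fin.sum_univ_succ]
    simp
  rw [natDegree_mul (pow_ne_zero _ (X_sub_C_ne_zero _)) (pow_ne_zero _ (rootProd_ne_zero T)),
    natDegree_pow, natDegree_pow, natDegree_X_sub_C, natDegree_rootProd, mul_one] at h2
  have h4 : 2 * s = (m - 1) * (m - 2) := sum_fin_sub_one m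
  have h5 : 2 * (n * (n - 1) / 2) = n * (n - 1) :=
    Nat.mul_div_cancel' (Nat.even_mul_pred_self n).two_dvd
  obtain rfl | hm2 : m = 1 ∨ 2 ≤ m := by omega
  · have : s = 0 := by simpa using h4
    rw [this] at h2 h3
    simp at h2 h3
    have : 2 * 1 ≤ n * (n - 1) := Nat.mul_le_mul hn (by omega)
    omega
  · obtain ⟨a, rfl⟩ : ∃ a, m = a + 2 := ⟨m - 2, by omega⟩
    obtain ⟨b, rfl⟩ : ∃ b, n = a + 2 + b := ⟨n - (a + 2), by omega⟩
    simp only [Nat.add_sub_cancel, show a + 2 - 1 = a + 1 by omega,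
      show a + 2 + b - 1 = a + 1 + b by omega] at *
    set r := s - a with hr
    have h6 : a ≤ s := by nlinarith
    have h7 : s = r + a := by omega
    rw [h7] at h3 h4
    have h8 : μ + r * (a + 2 + b) ≤ 1 + (r + a) * (a + 1 + b) := h2.trans h3
    nlinarith [h8, h4, h5]

end OkuboRows

section OkuboFrame
open Polynomial

theorem det_mul_eq_of_det_fromBlocks_eq_zero {R : Type*} [CommRing R] [IsDomain R] {m : ℕ}
    {A : Matrix (Fin m) (Fin m) R} (hA : A.det ≠ 0) (b r : Fin m → R) (d : R)
    (h : (Matrix.fromBlocks A (Matrix.of fun j (_ : Fin 1) => b j)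
      (Matrix.of fun (_ : Fin 1) c => r c) (Matrix.of fun (_ _ : Fin 1) => d)).det = 0) :
    A.det * d = ∑ c, r c * ∑ j, A.adjugate c j * b j := by
  set Bm : Matrix (Fin m) (Fin 1) R := Matrix.of fun j _ => b j with hB
  set Rm : Matrix (Fin 1) (Fin m) R := Matrix.of fun _ c => r c with hR
  set Dm : Matrix (Fin 1) (Fin 1) R := Matrix.of fun _ _ => d with hD
  have h1 : Matrix.fromBlocks A Bm Rm Dm
        * Matrix.fromBlocks A.adjugate (-(A.adjugate * Bm)) 0 (A.det • (1 : Matrix _ _ R))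
      = Matrix.fromBlocks (A.det • (1 : Matrix _ _ R)) 0 (Rm * A.adjugate)
        (A.det • Dm - Rm * (A.adjugate * Bm)) := by
    rw [Matrix.fromBlocks_multiply]
    congr 1
    · simp [Matrix.mul_adjugate]
    · rw [Matrix.mul_neg, ← Matrix.mul_assoc, Matrix.mul_adjugate]; simp
    · simp
    · rw [Matrix.mul_neg]; simp [sub_eq_add_neg, add_comm]
  have h2 := congrArg Matrix.det h1
  rw [Matrix.det_mul, h, zero_mul, Matrix.det_fromBlocks_zero₁₂, eq_comm, mul_eq_zero] at h2
  have h3 := h2.resolve_left (by simp [hA])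
  rw [Matrix.det_fin_one] at h3
  have h4 : A.det * d - ∑ c, r c * ∑ j, A.adjugate c j * b j = 0 := by
    rw [← h3]; simp [hD, hR, hB, Matrix.mul_apply]
  exact sub_eq_zero.1 h4

variable {n : ℕ}

theorem okuboOp_smul (T : Fin n → ℂ) (B : Fin n → Fin n → ℂ) (g : ℂ[X]) (u : Fin n → ℂ[X]) :
    okuboOp T B (g • u) = (rootProd T * derivative g) • u + g • okuboOp T B u := by
  ext1 l
  simp only [okuboOp, Pi.smul_apply, Pi.add_apply, smul_eq_mul, derivative_mul, mul_add,
    Finset.mul_sum]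
  have h1 : ∀ i, g * u i * (rootProdErase T i * C (B i l))
      = g * (u i * (rootProdErase T i * C (B i l))) := fun i => by ring
  simp only [h1]
  ring

theorem okuboOp_sum (T : Fin n → ℂ) (B : Fin n → Fin n → ℂ) {ι : Type*} (s : Finset ι)
    (u : ι → Fin n → ℂ[X]) : okuboOp T B (∑ j ∈ s, u j) = ∑ j ∈ s, okuboOp T B (u j) := by
  ext1 l
  simp only [okuboOp, Finset.sum_apply, derivative_sum, Finset.mul_sum, Finset.sum_add_distrib,
    Finset.sum_mul]
  rw [Finset.sum_comm]

theorem okuboOp_okuboRow_zero (T : Fin n → ℂ) {B : Fin n → Fin n → ℂ} (h : Fin n → ℂ) :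
    okuboOp T B (okuboRow T B h 0) = rootProd T • okuboRow T B h 1 := by
  ext1 l
  have : ∀ i, okuboRow T B h 0 i * (rootProdErase T i * C (B i l))
      = rootProd T * C (h i * B i l) := by
    intro i
    rw [rootProd_eq_mul T i, okuboRow, C_mul]; ring
  simp only [okuboOp, this, ← Finset.mul_sum, ← mul_add, Pi.smul_apply, smul_eq_mul]
  simp [okuboRow]

theorem okuboOp_okuboRow_succ (T : Fin n → ℂ) (B : Fin n → Fin n → ℂ) (h : Fin n → ℂ) (j : ℕ) :
    okuboOp T B (okuboRow T B h (j + 1)) = okuboRow T B h (j + 2)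
      + ((j : ℂ[X]) * derivative (rootProd T)) • okuboRow T B h (j + 1) := by
  ext1 l
  simp only [okuboOp, Pi.add_apply, Pi.smul_apply, okuboRow_add_two, smul_eq_mul]
  ring

theorem det_okuboMinor_eq_zero_of_lt (T : Fin n → ℂ) (B : Fin n → Fin n → ℂ) (h : Fin n → ℂ)
    {m : ℕ} (hm : n < m) (σ : Fin m → Fin n) : (okuboMinor T B h σ).det = 0 := by
  obtain ⟨i, j, hij, hσ⟩ := Fintype.exists_ne_map_eq_of_card_lt σ (by simpa using hm)
  exact Matrix.det_zero_of_column_eq hij fun k => by simp [okuboMinor, hσ]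

/-- A frame, regular at `t₀`, of the saturated module spanned by the rows. -/
theorem exists_okubo_frame (T : Fin n → ℂ) (B : Fin n → Fin n → ℂ) (h : Fin n → ℂ)
    (h0 : ∃ l, okuboRow T B h 0 l ≠ 0) (t₀ : ℂ) :
    ∃ m, 1 ≤ m ∧ m ≤ n ∧ ∃ σ : Fin m → Fin n, (okuboMinor T B h σ).det ≠ 0 ∧
      ∃ (θ : ℂ[X]) (b : Fin m → Fin n → ℂ[X]) (a : Fin m → Fin m → ℂ[X]), θ.eval t₀ ≠ 0 ∧
        (∀ c l, (X - C t₀) ^ (okuboMinor T B h σ).det.rootMultiplicity t₀ * b c l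
          = ∑ j : Fin m, a c j * okuboRow T B h j l) ∧
        (∀ l, θ * okuboRow T B h 0 l = ∑ c, okuboRow T B h 0 (σ c) * b c l) ∧
        ∀ c l, θ * okuboOp T B (b c) l = ∑ c', okuboOp T B (b c) (σ c') * b c' l := by
  classical
  have hex : ∃ m, ∀ σ : Fin (m + 1) → Fin n, (okuboMinor T B h σ).det = 0 :=
    ⟨n, fun σ => det_okuboMinor_eq_zero_of_lt T B h n.lt_succ_self σ⟩
  set m := Nat.find hex with hm
  have hspec : ∀ σ : Fin (m + 1) → Fin n, (okuboMinor T B h σ).det = 0 := Nat.find_spec hex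
  have hm1 : 1 ≤ m := by
    rw [Nat.one_le_iff_ne_zero, hm, Ne, Nat.find_eq_zero]
    obtain ⟨l, hl⟩ := h0
    intro hall
    apply hl
    simpa [okuboMinor] using hall fun _ => l
  have hS : {σ : Fin m → Fin n | (okuboMinor T B h σ).det ≠ 0}.Nonempty := by
    have := Nat.find_min hex (m := m - 1) (by omega)
    rw [show m - 1 + 1 = m by omega] at this
    push Not at this
    exact this
  obtain ⟨σ, hσ, hmin⟩ := Set.exists_min_image _
    (fun σ => (okuboMinor T B h σ).det.rootMultiplicity t₀) (Set.toFinite _) hS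
  have hmn : m ≤ n := by
    by_contra hlt
    exact hσ (det_okuboMinor_eq_zero_of_lt T B h (by omega) σ)
  set A := okuboMinor T B h σ with hA
  set μ := A.det.rootMultiplicity t₀ with hμ
  have hπ : (X - C t₀ : ℂ[X]) ^ μ ≠ 0 := pow_ne_zero _ (X_sub_C_ne_zero _)
  obtain ⟨θ, hθ, hθdvd⟩ := exists_eq_pow_rootMultiplicity_mul_and_not_dvd A.det hσ t₀
  rw [dvd_iff_isRoot] at hθdvd
  have hdvd : ∀ c l, (X - C t₀) ^ μ ∣ ∑ j : Fin m, A.adjugate c j * okuboRow T B h j l := by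
    intro c l
    have h1 : ∑ j : Fin m, A.adjugate c j * okuboRow T B h j l
        = (okuboMinor T B h (Function.update σ c l)).det := by
      have h2 := congrFun (Matrix.cramer_eq_adjugate_mulVec A fun j : Fin m => okuboRow T B h j l) c
      rw [Matrix.cramer_apply] at h2
      rw [show ∑ j : Fin m, A.adjugate c j * okuboRow T B h j l = _ from h2.symm]
      congr 1
      ext1 j c'
      by_cases hc : c' = c
      · subst hc; simp [okuboMinor]
      · simp [okuboMinor, hA, hc]
    rw [h1]
    by_cases h2 : (okuboMinor T B h (Function.update σ c l)).det = 0
    · rw [h2]; exact dvd_zero _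
    · exact (pow_dvd_pow _ (hmin _ h2)).trans (pow_rootMultiplicity_dvd _ _)
  choose b hb using hdvd
  have hbu : ∀ c, (X - C t₀ : ℂ[X]) ^ μ • b c
      = ∑ j : Fin m, A.adjugate c j • okuboRow T B h j := by
    intro c; ext1 l
    simp only [Pi.smul_apply, smul_eq_mul, Finset.sum_apply]
    exact (hb c l).symm
  let V : Submodule ℂ[X] (Fin n → ℂ[X]) :=
    { carrier := {r | ∀ l, θ * r l = ∑ c, r (σ c) * b c l}
      zero_mem' := by simp
      add_mem' := by
        intro r s hr hs l
        simp only [Pi.add_apply, mul_add, add_mul, Finset.sum_add_distrib]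
        rw [hr l, hs l]
      smul_mem' := by
        intro g r hr l
        simp only [Pi.smul_apply, smul_eq_mul, mul_assoc, ← Finset.mul_sum]
        rw [← hr l]; ring }
  have hV : ∀ r, r ∈ V ↔ ∀ l, A.det * r l
      = ∑ c, r (σ c) * ∑ j : Fin m, A.adjugate c j * okuboRow T B h j l := by
    intro r
    refine forall_congr' fun l => ?_
    simp only [hb]
    rw [hθ, mul_assoc, ← mul_right_inj' hπ, Finset.mul_sum]
    simp only [mul_left_comm, ← hμ]
  have hcancel : ∀ (g : ℂ[X]) r, g ≠ 0 → g • r ∈ V → r ∈ V := by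
    intro g r hg hr l
    have := hr l
    simp only [Pi.smul_apply, smul_eq_mul, mul_assoc, ← Finset.mul_sum] at this
    rw [mul_left_comm] at this
    exact mul_left_cancel₀ hg this
  have hrow : ∀ j ≤ m, okuboRow T B h j ∈ V := by
    intro j hj
    rw [hV]
    intro l
    obtain hj | rfl := hj.lt_or_eq
    · have h1 : ∀ i : Fin m, ∑ c, A ⟨j, hj⟩ c * A.adjugate c i = if (⟨j, hj⟩ : Fin m) = i
          then A.det else 0 := by
        intro i
        rw [← Matrix.mul_apply, Matrix.mul_adjugate, Matrix.smul_apply, Matrix.one_apply]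
        simp
      simp only [Finset.mul_sum, ← mul_assoc]
      rw [Finset.sum_comm]
      simp only [← Finset.sum_mul]
      have h2 : ∀ i : Fin m, ∑ c, okuboRow T B h j (σ c) * A.adjugate c i
          = if (⟨j, hj⟩ : Fin m) = i then A.det else 0 := h1
      simp [h2]
    · refine det_mul_eq_of_det_fromBlocks_eq_zero hσ (fun j : Fin m => okuboRow T B h j l)
        (fun c => okuboRow T B h m (σ c)) _ ?_
      have h1 := hspec (Fin.append σ fun _ : Fin 1 => l)
      rw [← Matrix.det_submatrix_equiv_self finSumFinEquiv] at h1
      rw [← h1]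
      congr 1
      ext1 i k
      rcases i with i | i <;> rcases k with k | k <;>
        simp [okuboMinor]
  have hop : ∀ j < m, okuboOp T B (okuboRow T B h j) ∈ V := by
    intro j hj
    cases j with
    | zero =>
      rw [okuboOp_okuboRow_zero]
      exact V.smul_mem _ (hrow 1 hm1)
    | succ j =>
      rw [okuboOp_okuboRow_succ]
      exact V.add_mem (hrow _ hj) (V.smul_mem _ (hrow _ hj.le))
  have hbV : ∀ c, b c ∈ V := fun c => hcancel _ _ hπ <| by
    rw [hbu]
    exact V.sum_mem fun j _ => V.smul_mem _ (hrow _ j.2.le)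
  have hopb : ∀ c, okuboOp T B (b c) ∈ V := fun c => hcancel _ _ hπ <| by
    have h1 := okuboOp_smul T B ((X - C t₀) ^ μ) (b c)
    rw [hbu, okuboOp_sum] at h1
    rw [eq_sub_of_add_eq' h1.symm]
    refine V.sub_mem (V.sum_mem fun j _ => ?_) (V.smul_mem _ (hbV c))
    rw [okuboOp_smul]
    exact V.add_mem (V.smul_mem _ (hrow _ j.2.le)) (V.smul_mem _ (hop _ j.2))
  exact ⟨m, hm1, hmn, σ, hσ, θ, b, fun c j => A.adjugate c j, hθdvd,
    fun c l => (hb c l).symm, hrow 0 (Nat.zero_le _), hopb⟩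

end OkuboFrame

section OrderBound
open Polynomial Filter Topology

theorem natCast_le_analyticOrderAt_sum_mul {ι : Type*} (s : Finset ι) {g f : ι → ℂ → ℂ} {t₀ : ℂ}
    (hg : ∀ i, AnalyticAt ℂ (g i) t₀) (hf : ∀ i, AnalyticAt ℂ (f i) t₀) {N : ℕ}
    (hN : ∀ i ∈ s, (N : ℕ∞) ≤ analyticOrderAt (f i) t₀) :
    (N : ℕ∞) ≤ analyticOrderAt (fun t => ∑ i ∈ s, g i t * f i t) t₀ := by
  classical
  induction s using Finset.induction_on with
  | empty =>
    simp only [Finset.sum_empty]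
    rw [analyticOrderAt_eq_top.2 (by simp)]
    exact le_top
  | insert a s ha ih =>
    simp only [Finset.sum_insert ha]
    refine le_trans (le_min ?_ (ih fun i hi => hN i (Finset.mem_insert_of_mem hi)))
      le_analyticOrderAt_add
    have h1 : analyticOrderAt (fun t => g a t * f a t) t₀ = _ := analyticOrderAt_mul (hg a) (hf a)
    rw [h1]
    exact (hN a (Finset.mem_insert_self _ _)).trans le_add_self

variable {n : ℕ}

/-- The pairing of a polynomial row with a vector of functions. -/
noncomputable def rowPair (J : Fin n → ℂ → ℂ) (u : Fin n → ℂ[X]) (t : ℂ) : ℂ :=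
  ∑ l, (u l).eval t * J l t

theorem Polynomial.analyticAt_eval (p : ℂ[X]) (t : ℂ) : AnalyticAt ℂ (fun t => p.eval t) t := by
  simpa using (analyticAt_id (𝕜 := ℂ) (z := t)).aeval_polynomial p

theorem analyticAt_rowPair {J : Fin n → ℂ → ℂ} {t₀ : ℂ} (hJ : ∀ l, AnalyticAt ℂ (J l) t₀)
    (u : Fin n → ℂ[X]) : AnalyticAt ℂ (rowPair J u) t₀ :=
  Finset.analyticAt_fun_sum _ fun l _ => ((u l).analyticAt_eval t₀).mul (hJ l)

theorem rowPair_smul (J : Fin n → ℂ → ℂ) (g : ℂ[X]) (u : Fin n → ℂ[X]) (t : ℂ) :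
    rowPair J (g • u) t = g.eval t * rowPair J u t := by
  simp [rowPair, Finset.mul_sum, mul_assoc]

theorem rowPair_add (J : Fin n → ℂ → ℂ) (u v : Fin n → ℂ[X]) (t : ℂ) :
    rowPair J (u + v) t = rowPair J u t + rowPair J v t := by
  simp [rowPair, Finset.sum_add_distrib, add_mul]

theorem rowPair_sum (J : Fin n → ℂ → ℂ) {ι : Type*} (s : Finset ι) (u : ι → Fin n → ℂ[X]) (t : ℂ) :
    rowPair J (∑ i ∈ s, u i) t = ∑ i ∈ s, rowPair J (u i) t := by
  simp only [rowPair, Finset.sum_apply, eval_finsetSum, Finset.sum_mul]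
  rw [Finset.sum_comm]

theorem eventually_mul_deriv_rowPair {T : Fin n → ℂ} {B : Fin n → Fin n → ℂ}
    {J : Fin n → ℂ → ℂ} {t₀ : ℂ} (hJ : ∀ l, AnalyticAt ℂ (J l) t₀)
    (hode : ∀ k, ∀ᶠ t in 𝓝 t₀, (t - T k) * deriv (J k) t = ∑ l, B k l * J l t)
    (u : Fin n → ℂ[X]) :
    ∀ᶠ t in 𝓝 t₀, (rootProd T).eval t * deriv (rowPair J u) t = rowPair J (okuboOp T B u) t := by
  filter_upwards [eventually_all.2 hode, eventually_all.2 fun l => (hJ l).eventually_analyticAt]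
    with t ht hta
  have hd : HasDerivAt (rowPair J u)
      (∑ l, ((derivative (u l)).eval t * J l t + (u l).eval t * deriv (J l) t)) t :=
    HasDerivAt.fun_sum fun l _ => ((u l).hasDerivAt t).mul (hta l).differentiableAt.hasDerivAt
  have h1 : ∀ l, (rootProd T).eval t * ((derivative (u l)).eval t * J l t
      + (u l).eval t * deriv (J l) t) = (rootProd T).eval t * (derivative (u l)).eval t * J l t
        + ∑ i, (u l).eval t * ((rootProdErase T l).eval t * B l i) * J i t := by
    intro l
    have h2 : (rootProd T).eval t = (t - T l) * (rootProdErase T l).eval t := by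
      rw [rootProd_eq_mul T l]; simp
    have h3 : ∑ i, (u l).eval t * ((rootProdErase T l).eval t * B l i) * J i t
        = (u l).eval t * (rootProdErase T l).eval t * ∑ i, B l i * J i t := by
      rw [Finset.mul_sum]
      exact Finset.sum_congr rfl fun i _ => by ring
    rw [h3, ← ht l, h2]; ring
  rw [hd.deriv, Finset.mul_sum, Finset.sum_congr rfl fun l _ => h1 l, Finset.sum_add_distrib,
    Finset.sum_comm, ← Finset.sum_add_distrib]
  refine Finset.sum_congr rfl fun l _ => ?_
  simp only [okuboOp, eval_add, eval_mul, eval_finsetSum, eval_C, add_mul, Finset.sum_mul]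

theorem eval_rootProd_ne_zero {T : Fin n → ℂ} {t : ℂ} (ht : ∀ k, t ≠ T k) :
    (rootProd T).eval t ≠ 0 := by
  rw [rootProd, eval_prod]
  exact Finset.prod_ne_zero_iff.2 fun k _ => by simpa [sub_eq_zero] using ht k

theorem eventually_rowPair_okuboRow {T : Fin n → ℂ} {B : Fin n → Fin n → ℂ} {h : Fin n → ℂ}
    {J : Fin n → ℂ → ℂ} {f : ℂ → ℂ} {t₀ : ℂ} (ht₀ : ∀ k, t₀ ≠ T k)
    (hJ : ∀ l, AnalyticAt ℂ (J l) t₀)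
    (hode : ∀ k, ∀ᶠ t in 𝓝 t₀, (t - T k) * deriv (J k) t = ∑ l, B k l * J l t)
    (hf : f =ᶠ[𝓝 t₀] rowPair J (okuboRow T B h 0)) (j : ℕ) :
    ∀ᶠ t in 𝓝 t₀, rowPair J (okuboRow T B h j) t
      = (rootProd T).eval t ^ (j - 1) * deriv^[j] f t := by
  have hfa : AnalyticAt ℂ f t₀ := (analyticAt_rowPair hJ _).congr hf.symm
  match j with
  | 0 => filter_upwards [hf] with t ht; simp [ht]
  | j + 1 =>
    induction j with
    | zero =>
      have hP : ∀ᶠ t in 𝓝 t₀, (rootProd T).eval t ≠ 0 :=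
        ((rootProd T).analyticAt_eval t₀).continuousAt.eventually_ne (eval_rootProd_ne_zero ht₀)
      filter_upwards [eventually_mul_deriv_rowPair hJ hode (okuboRow T B h 0), hf.deriv, hP]
        with t h1 h2 h3
      rw [okuboOp_okuboRow_zero, rowPair_smul, ← h2] at h1
      simpa using (mul_left_cancel₀ h3 h1).symm
    | succ j ih =>
      have ih' : rowPair J (okuboRow T B h (j + 1)) =ᶠ[𝓝 t₀]
        fun t => (rootProd T).eval t ^ j * deriv^[j + 1] f t := ih
      filter_upwards [eventually_mul_deriv_rowPair hJ hode (okuboRow T B h (j + 1)), ih', ih'.deriv,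
        (hfa.iterated_deriv (j + 1)).eventually_analyticAt] with t h1 h2 h3 h4
      have h5 : HasDerivAt (fun t => (rootProd T).eval t ^ j * deriv^[j + 1] f t) _ t :=
        (((rootProd T).hasDerivAt t).pow j).mul h4.differentiableAt.hasDerivAt
      rw [okuboOp_okuboRow_succ, rowPair_add, rowPair_smul, h2, h3, h5.deriv] at h1
      have h6 : deriv^[j + 2] f t = deriv (deriv^[j + 1] f) t := by
        rw [Function.iterate_succ_apply']
      rw [show j + 1 + 1 = j + 2 from rfl, h6, show j + 2 - 1 = j + 1 from rfl]
      have h7 : (j : ℂ) * (rootProd T).eval t ^ (j - 1) * (rootProd T).eval t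
          = j * (rootProd T).eval t ^ j := by
        cases j with
        | zero => simp
        | succ j => rw [Nat.add_sub_cancel, mul_assoc, ← pow_succ]
      simp only [eval_mul, eval_natCast, Pi.pow_apply] at h1
      linear_combination -h1 + (derivative (rootProd T)).eval t * deriv^[j + 1] f t * h7

theorem natCast_le_analyticOrderAt_iterate_deriv {f : ℂ → ℂ} {t₀ : ℂ} (hf : AnalyticAt ℂ f t₀)
    {N j M : ℕ} (h : (N : ℕ∞) ≤ analyticOrderAt f t₀) (hM : M + j ≤ N) :
    (M : ℕ∞) ≤ analyticOrderAt (deriv^[j] f) t₀ := by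
  rw [natCast_le_analyticOrderAt_iff_iteratedDeriv_eq_zero hf] at h
  rw [natCast_le_analyticOrderAt_iff_iteratedDeriv_eq_zero (hf.iterated_deriv j)]
  intro i hi
  rw [iteratedDeriv_eq_iterate, ← Function.iterate_add_apply, ← iteratedDeriv_eq_iterate]
  exact h _ (by omega)

/-- A solution of a regular linear system vanishing at a regular point is zero. -/
theorem eventually_eq_zero_of_linear_system {m : ℕ} {z : Fin m → ℂ → ℂ} {t₀ : ℂ}
    (hz : ∀ c, AnalyticAt ℂ (z c) t₀) (hz0 : ∀ c, z c t₀ = 0) {Q : ℂ → ℂ}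
    (hQ : AnalyticAt ℂ Q t₀) (hQ0 : Q t₀ ≠ 0) {g : Fin m → Fin m → ℂ → ℂ}
    (hg : ∀ c c', AnalyticAt ℂ (g c c') t₀)
    (h : ∀ c, ∀ᶠ t in 𝓝 t₀, Q t * deriv (z c) t = ∑ c', g c c' t * z c' t) (c : Fin m) :
    ∀ᶠ t in 𝓝 t₀, z c t = 0 := by
  have key : ∀ N : ℕ, ∀ c, (N : ℕ∞) ≤ analyticOrderAt (z c) t₀ := by
    intro N
    induction N with
    | zero => simp
    | succ N ih =>
      intro c
      rw [Nat.cast_add_one, ← analyticOrderAt_deriv_ge_iff (hz c) (hz0 c)]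
      have h1 := natCast_le_analyticOrderAt_sum_mul Finset.univ (hg c) hz fun c' _ => ih c'
      rw [← analyticOrderAt_congr (h c)] at h1
      have h2 : analyticOrderAt (fun t => Q t * deriv (z c) t) t₀ = _ :=
        analyticOrderAt_mul hQ (hz c).deriv
      rwa [h2, hQ.analyticOrderAt_eq_zero.2 hQ0, zero_add] at h1
  exact analyticOrderAt_eq_top.1 (ENat.eq_top_iff_forall_ge.2 fun N => key N c)

/-- The multiplicity bound for linear combinations of solutions of an Okubo system. -/
theorem analyticOrderAt_okubo_le {T : Fin n → ℂ} (hT : Function.Injective T)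
    {B : Fin n → Fin n → ℂ} (hB : ∀ k, B k k = 0) (hn : 2 ≤ n) (h : Fin n → ℂ)
    {J : Fin n → ℂ → ℂ} {f : ℂ → ℂ} {t₀ : ℂ} (ht₀ : ∀ k, t₀ ≠ T k)
    (hJ : ∀ l, AnalyticAt ℂ (J l) t₀)
    (hode : ∀ k, ∀ᶠ t in 𝓝 t₀, (t - T k) * deriv (J k) t = ∑ l, B k l * J l t)
    (hf : f =ᶠ[𝓝 t₀] fun t => ∑ k, h k * (t - T k) * J k t) (hf0 : ¬ ∀ᶠ t in 𝓝 t₀, f t = 0) :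
    analyticOrderAt f t₀ ≤ (n - 1 + n * (n - 1) / 2 : ℕ) := by
  have hf' : f =ᶠ[𝓝 t₀] rowPair J (okuboRow T B h 0) := by
    filter_upwards [hf] with t ht
    rw [ht]; simp [rowPair, okuboRow]
  have hfa : AnalyticAt ℂ f t₀ := (analyticAt_rowPair hJ _).congr hf'.symm
  have h0 : ∃ l, okuboRow T B h 0 l ≠ 0 := by
    by_contra! hall
    refine hf0 ?_
    filter_upwards [hf'] with t ht
    rw [ht]; simp [rowPair, hall]
  obtain ⟨m, hm1, hmn, σ, hσ, θ, b, a, hθ, hba, h1, h2⟩ := exists_okubo_frame T B h h0 t₀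
  have hbound := rootMultiplicity_det_okuboMinor_le hT hB h hn hm1 hmn σ hσ ht₀
  set μ := (okuboMinor T B h σ).det.rootMultiplicity t₀ with hμ
  by_contra! hlt
  have hord : ((m + μ : ℕ) : ℕ∞) ≤ analyticOrderAt f t₀ := by
    refine le_trans ?_ (Order.add_one_le_of_lt hlt)
    exact_mod_cast (by omega : m + μ ≤ n - 1 + n * (n - 1) / 2 + 1)
  have hz : ∀ c, AnalyticAt ℂ (rowPair J (b c)) t₀ := fun c => analyticAt_rowPair hJ _
  have hz0 : ∀ c, rowPair J (b c) t₀ = 0 := by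
    intro c
    have h3 : (X - C t₀ : ℂ[X]) ^ μ • b c = ∑ j : Fin m, a c j • okuboRow T B h j := by
      ext1 l
      simpa using hba c l
    have h4 : ∀ᶠ t in 𝓝 t₀, (t - t₀) ^ μ * rowPair J (b c) t
        = ∑ j : Fin m, ((a c j).eval t * (rootProd T).eval t ^ ((j : ℕ) - 1)) * deriv^[j] f t := by
      filter_upwards [eventually_all.2 fun j : Fin m =>
        eventually_rowPair_okuboRow ht₀ hJ hode hf' j] with t ht
      have h5 := congrArg (fun u => rowPair J u t) h3
      simp only [rowPair_smul, rowPair_sum, ht] at h5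
      simpa [mul_assoc] using h5
    have h5 := natCast_le_analyticOrderAt_sum_mul (t₀ := t₀) (N := μ + 1)
      (Finset.univ : Finset (Fin m))
      (g := fun j t => (a c j).eval t * (rootProd T).eval t ^ ((j : ℕ) - 1))
      (f := fun j => deriv^[j] f)
      (fun j => ((a c j).analyticAt_eval t₀).mul (((rootProd T).analyticAt_eval t₀).pow _))
      (fun j => hfa.iterated_deriv j)
      fun j _ => natCast_le_analyticOrderAt_iterate_deriv hfa hord (by have := j.2; omega)
    rw [← analyticOrderAt_congr h4] at h5
    have h6 : AnalyticAt ℂ (fun t => (t - t₀) ^ μ) t₀ := by fun_prop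
    have h7 : analyticOrderAt (fun t => (t - t₀) ^ μ * rowPair J (b c) t) t₀ = _ :=
      analyticOrderAt_mul h6 (hz c)
    have h8 : analyticOrderAt (fun t => (t - t₀) ^ μ) t₀ = μ := analyticOrderAt_centeredMonomial
    rw [h7, h8, Nat.cast_add, ENat.add_le_add_iff_left (ENat.natCast_ne_top μ)] at h5
    refine apply_eq_zero_of_analyticOrderAt_ne_zero fun h9 => ?_
    rw [h9] at h5
    simp at h5
  have hzero := eventually_eq_zero_of_linear_system hz hz0
    (Q := fun t => θ.eval t * (rootProd T).eval t)
    ((θ.analyticAt_eval t₀).mul ((rootProd T).analyticAt_eval t₀))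
    (mul_ne_zero hθ (eval_rootProd_ne_zero ht₀))
    (g := fun c c' t => (okuboOp T B (b c) (σ c')).eval t)
    (fun c c' => Polynomial.analyticAt_eval _ t₀) (fun c => by
      filter_upwards [eventually_mul_deriv_rowPair hJ hode (b c)] with t ht
      have h3 : θ • okuboOp T B (b c) = ∑ c', okuboOp T B (b c) (σ c') • b c' := by
        ext1 l
        simpa using h2 c l
      have h5 := congrArg (fun u => rowPair J u t) h3
      simp only [rowPair_smul, rowPair_sum] at h5
      rw [mul_assoc, ht, h5])
  have hθ' : ∀ᶠ t in 𝓝 t₀, θ.eval t ≠ 0 :=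
    (θ.analyticAt_eval t₀).continuousAt.eventually_ne hθ
  refine hf0 ?_
  filter_upwards [eventually_all.2 hzero, hθ', hf'] with t ht1 ht2 ht3
  have h3 : θ • okuboRow T B h 0 = ∑ c, okuboRow T B h 0 (σ c) • b c := by
    ext1 l
    simpa using h1 l
  have h5 := congrArg (fun u => rowPair J u t) h3
  simp only [rowPair_smul, rowPair_sum, ht1, mul_zero, Finset.sum_const_zero] at h5
  rw [ht3]
  exact (mul_eq_zero.1 h5).resolve_left ht2

end OrderBound

section FlatSections
open Metric

theorem hasDerivAt_tsum_of_geometric_bound {a : ℕ → ℂ} {K M : ℝ} (hM : 0 < M)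
    (ha : ∀ j, ‖a j‖ ≤ K * M ^ j) {s : ℂ} (hs : s ∈ ball (0 : ℂ) (1 / (2 * M))) :
    (Summable fun j => a j * s ^ j) ∧ (Summable fun j : ℕ => (j : ℂ) * a j * s ^ (j - 1)) ∧
      HasDerivAt (fun s => ∑' j, a j * s ^ j) (∑' j : ℕ, (j : ℂ) * a j * s ^ (j - 1)) s := by
  have hK : 0 ≤ K := by simpa using (norm_nonneg _).trans (ha 0)
  set u : ℕ → ℝ := fun j => K * (2 * M) * ((j : ℝ) ^ 1 * (1 / 2 : ℝ) ^ j) with hu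
  have hus : Summable u :=
    (summable_pow_mul_geometric_of_norm_lt_one 1 (by norm_num : ‖(1 / 2 : ℝ)‖ < 1)).mul_left _
  have hbound : ∀ (j : ℕ) (y : ℂ), y ∈ ball (0 : ℂ) (1 / (2 * M)) →
      ‖(j : ℂ) * a j * y ^ (j - 1)‖ ≤ u j := by
    intro j y hy
    cases j with
    | zero => simp [hu]
    | succ j =>
      have hy' : ‖y‖ ≤ 1 / (2 * M) := (mem_ball_zero_iff.1 hy).le
      rw [norm_mul, norm_mul, norm_pow, Nat.add_sub_cancel, Complex.norm_natCast]
      calc ((j + 1 : ℕ) : ℝ) * ‖a (j + 1)‖ * ‖y‖ ^ j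
          ≤ ((j + 1 : ℕ) : ℝ) * (K * M ^ (j + 1)) * (1 / (2 * M)) ^ j := by
            gcongr
            exact ha _
        _ = u (j + 1) := by
            simp only [hu, one_div, inv_pow, mul_inv, mul_pow, pow_succ]
            field_simp
  have hderiv := hasDerivAt_tsum_of_isPreconnected (g := fun j y => a j * y ^ j)
    (g' := fun j y => (j : ℂ) * a j * y ^ (j - 1)) hus isOpen_ball
    (convex_ball (0 : ℂ) _).isPreconnected
    (fun j y _ => by
      have := (hasDerivAt_pow j y).const_mul (a j)
      rwa [← mul_assoc, mul_comm (a j)] at this)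
    hbound (mem_ball_self (by positivity : 0 < 1 / (2 * M)))
    (summable_of_ne_finset_zero (s := {0}) fun j hj => by
      simp at hj; simp [hj]) hs
  refine ⟨?_, Summable.of_norm_bounded hus fun j => hbound j s hs, hderiv⟩
  have hs' : ‖s‖ ≤ 1 / (2 * M) := (mem_ball_zero_iff.1 hs).le
  refine Summable.of_norm_bounded (g := fun j => K * (1 / 2 : ℝ) ^ j)
    ((summable_geometric_of_lt_one (by norm_num) (by norm_num)).mul_left _) fun j => ?_
  rw [norm_mul, norm_pow]
  calc ‖a j‖ * ‖s‖ ^ j ≤ (K * M ^ j) * (1 / (2 * M)) ^ j := by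
        gcongr
        exact ha _
    _ = K * (1 / 2) ^ j := by rw [mul_assoc, ← mul_pow]; congr 2; field_simp

/-- Local solutions of the linear system dual to an Okubo system. -/
theorem exists_flat_section {n : ℕ} {T : Fin n → ℂ} (c : Fin n → Fin n → ℂ) {t₁ : ℂ}
    (ht₁ : ∀ k, t₁ ≠ T k) (φ₀ : Fin n → ℂ) :
    ∃ r > 0, ∃ φ φ' : Fin n → ℂ → ℂ, (∀ l, φ l t₁ = φ₀ l) ∧
      ∀ l, ∀ t ∈ ball t₁ r, HasDerivAt (φ l) (φ' l t) t ∧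
        (t - T l) * φ' l t + φ l t + ∑ k, φ k t * c k l = 0 := by
  let a : ℕ → Fin n → ℂ := fun j => Nat.rec φ₀
    (fun j v l => (v l + (∑ k, v k * c k l) / (j + 1)) / (T l - t₁)) j
  have ha0 : a 0 = φ₀ := rfl
  have ha : ∀ j l, a (j + 1) l = (a j l + (∑ k, a j k * c k l) / (j + 1)) / (T l - t₁) :=
    fun j l => rfl
  have hd : ∀ l, T l - t₁ ≠ 0 := fun l => sub_ne_zero.2 (ht₁ l).symm
  have ha' : ∀ (j : ℕ) l, (T l - t₁) * (((j : ℂ) + 1) * a (j + 1) l)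
      = ((j : ℂ) + 1) * a j l + ∑ k, a j k * c k l := by
    intro j l
    have hj : (j + 1 : ℂ) ≠ 0 := Nat.cast_add_one_ne_zero j
    rw [ha]; field_simp [hd l]
  set M : ℝ := 1 + ∑ l, (1 + ∑ k, ‖c k l‖) / ‖T l - t₁‖ with hM
  have hnn : ∀ l, 0 ≤ (1 + ∑ k, ‖c k l‖) / ‖T l - t₁‖ := fun l => by positivity
  have hM0 : 0 < M := by
    have := Finset.sum_nonneg fun l (_ : l ∈ Finset.univ) => hnn l
    linarith
  set K : ℝ := ∑ l, ‖φ₀ l‖ with hK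
  have hbound : ∀ j l, ‖a j l‖ ≤ K * M ^ j := by
    intro j
    induction j with
    | zero =>
      intro l
      rw [pow_zero, mul_one, ha0]
      exact Finset.single_le_sum (f := fun l => ‖φ₀ l‖) (fun _ _ => norm_nonneg _)
        (Finset.mem_univ l)
    | succ j ih =>
      intro l
      have hl : (1 + ∑ k, ‖c k l‖) / ‖T l - t₁‖ ≤ M := by
        have := Finset.single_le_sum (fun l _ => hnn l) (Finset.mem_univ l)
        linarith
      have h1 : ‖(∑ k, a j k * c k l) / (j + 1 : ℂ)‖ ≤ K * M ^ j * ∑ k, ‖c k l‖ := by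
        have hj : (1 : ℝ) ≤ ‖(j + 1 : ℂ)‖ := by
          have : (j + 1 : ℂ) = ((j + 1 : ℕ) : ℂ) := by push_cast; rfl
          rw [this, Complex.norm_natCast]; push_cast; linarith [j.cast_nonneg (α := ℝ)]
        rw [norm_div]
        refine (div_le_self (norm_nonneg _) hj).trans ((norm_sum_le _ _).trans ?_)
        rw [Finset.mul_sum]
        refine Finset.sum_le_sum fun k _ => ?_
        rw [norm_mul]
        exact mul_le_mul_of_nonneg_right (ih k) (norm_nonneg _)
      have hKM : 0 ≤ K * M ^ j := (norm_nonneg _).trans (ih l)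
      rw [ha, norm_div]
      calc ‖a j l + (∑ k, a j k * c k l) / (j + 1 : ℂ)‖ / ‖T l - t₁‖
          ≤ (K * M ^ j + K * M ^ j * ∑ k, ‖c k l‖) / ‖T l - t₁‖ := by
            gcongr
            exact (norm_add_le _ _).trans (add_le_add (ih l) h1)
        _ = K * M ^ j * ((1 + ∑ k, ‖c k l‖) / ‖T l - t₁‖) := by ring
        _ ≤ K * M ^ j * M := mul_le_mul_of_nonneg_left hl hKM
        _ = K * M ^ (j + 1) := by rw [pow_succ, mul_assoc]
  refine ⟨1 / (2 * M), by positivity, fun l t => ∑' j, a j l * (t - t₁) ^ j,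
    fun l t => ∑' j : ℕ, (j : ℂ) * a j l * (t - t₁) ^ (j - 1), fun l => ?_, fun l t ht => ?_⟩
  · have : ∀ j : ℕ, j ≠ 0 → a j l * (t₁ - t₁) ^ j = 0 := fun j hj => by simp [hj]
    simp only [tsum_eq_single 0 this, ha0, pow_zero, mul_one]
  have hs : t - t₁ ∈ ball (0 : ℂ) (1 / (2 * M)) := by
    simpa [dist_eq_norm] using ht
  have hall := fun l => hasDerivAt_tsum_of_geometric_bound hM0 (fun j => hbound j l) hs
  refine ⟨(hall l).2.2.comp_sub_const t t₁, ?_⟩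
  set s := t - t₁ with hsdef
  have h1 : HasSum (fun j : ℕ => (j : ℂ) * a j l * s ^ j)
      (s * ∑' j : ℕ, (j : ℂ) * a j l * s ^ (j - 1)) := by
    refine ((hall l).2.1.hasSum.mul_left s).congr_fun fun j => ?_
    cases j with
    | zero => simp
    | succ j => rw [Nat.add_sub_cancel, pow_succ]; ring
  have h2 : HasSum (fun j : ℕ => ((j : ℂ) + 1) * a (j + 1) l * s ^ j)
      (∑' j : ℕ, (j : ℂ) * a j l * s ^ (j - 1)) := by
    have := (hasSum_nat_add_iff' 1).2 (hall l).2.1.hasSum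
    simpa using this
  have h3 : HasSum (fun j => ∑ k, a j k * s ^ j * c k l)
      (∑ k, (∑' j, a j k * s ^ j) * c k l) :=
    hasSum_sum fun k _ => (hall k).1.hasSum.mul_right _
  have h4 := ((h1.sub (h2.mul_left (T l - t₁))).add (hall l).1.hasSum).add h3
  have h5 : ∀ j : ℕ, (j : ℂ) * a j l * s ^ j
      - (T l - t₁) * (((j : ℂ) + 1) * a (j + 1) l * s ^ j) + a j l * s ^ j
      + ∑ k, a j k * s ^ j * c k l = 0 := by
    intro j
    have h6 : ∑ k, a j k * s ^ j * c k l = s ^ j * ∑ k, a j k * c k l := by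
      rw [Finset.mul_sum]
      exact Finset.sum_congr rfl fun k _ => by ring
    rw [h6]
    linear_combination -s ^ j * ha' j l
  simp only [h5] at h4
  have h6 := h4.unique hasSum_zero
  rw [← h6, hsdef]; ring

end FlatSections

section ClosedForms
open MeasureTheory Set

/-- The integrals of a closed form `a dx + b dy` over two closed curves joined by a linear homotopy
inside its domain agree. -/
theorem integral_closedForm_eq_of_segment_mem {W : Set (ℂ × ℂ)}
    {a b ax ay bY : ℂ × ℂ → ℂ}
    (ha : ∀ z ∈ W, HasFDerivAt a
      (ax z • ContinuousLinearMap.fst ℂ ℂ ℂ + ay z • ContinuousLinearMap.snd ℂ ℂ ℂ) z)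
    (hb : ∀ z ∈ W, HasFDerivAt b
      (ay z • ContinuousLinearMap.fst ℂ ℂ ℂ + bY z • ContinuousLinearMap.snd ℂ ℂ ℂ) z)
    (hax : ContinuousOn ax W) (hay : ContinuousOn ay W) (hbY : ContinuousOn bY W)
    {x₀ y₀ x₁ y₁ x₀' y₀' x₁' y₁' : ℝ → ℂ}
    (hx₀ : ∀ s, HasDerivAt x₀ (x₀' s) s) (hy₀ : ∀ s, HasDerivAt y₀ (y₀' s) s)
    (hx₁ : ∀ s, HasDerivAt x₁ (x₁' s) s) (hy₁ : ∀ s, HasDerivAt y₁ (y₁' s) s)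
    (cx₀ : Continuous x₀') (cy₀ : Continuous y₀') (cx₁ : Continuous x₁') (cy₁ : Continuous y₁')
    (px₀ : x₀ 1 = x₀ 0) (py₀ : y₀ 1 = y₀ 0) (px₁ : x₁ 1 = x₁ 0) (py₁ : y₁ 1 = y₁ 0)
    (hmem : ∀ u ∈ Icc (0 : ℝ) 1, ∀ s ∈ Icc (0 : ℝ) 1,
      (x₀ s + u * (x₁ s - x₀ s), y₀ s + u * (y₁ s - y₀ s)) ∈ W) :
    ∫ s in (0 : ℝ)..1, (a (x₀ s, y₀ s) * x₀' s + b (x₀ s, y₀ s) * y₀' s) =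
      ∫ s in (0 : ℝ)..1, (a (x₁ s, y₁ s) * x₁' s + b (x₁ s, y₁ s) * y₁' s) := by
  have dx₀ : Continuous x₀ := continuous_iff_continuousAt.2 fun s => (hx₀ s).continuousAt
  have dy₀ : Continuous y₀ := continuous_iff_continuousAt.2 fun s => (hy₀ s).continuousAt
  have dx₁ : Continuous x₁ := continuous_iff_continuousAt.2 fun s => (hx₁ s).continuousAt
  have dy₁ : Continuous y₁ := continuous_iff_continuousAt.2 fun s => (hy₁ s).continuousAt
  have ca : ContinuousOn a W := fun z hz => (ha z hz).continuousAt.continuousWithinAt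
  have cb : ContinuousOn b W := fun z hz => (hb z hz).continuousAt.continuousWithinAt
  set Γ : ℝ × ℝ → ℂ × ℂ := fun q =>
    (x₀ q.2 + q.1 * (x₁ q.2 - x₀ q.2), y₀ q.2 + q.1 * (y₁ q.2 - y₀ q.2)) with hΓ
  have cΓ : Continuous Γ := by fun_prop
  have mΓ : MapsTo Γ (Icc 0 1 ×ˢ Icc 0 1) W := fun q hq => hmem q.1 hq.1 q.2 hq.2
  have compc : ∀ {f : ℂ × ℂ → ℂ}, ContinuousOn f W →
      ContinuousOn (fun q => f (Γ q)) (Icc (0 : ℝ) 1 ×ˢ Icc (0 : ℝ) 1) :=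
    fun hf => hf.comp cΓ.continuousOn mΓ
  -- the pullback of the form along the homotopy, and the common mixed derivative
  set D : ℝ → ℝ → ℂ := fun u s =>
    (ax (Γ (u, s)) * (x₁ s - x₀ s) + ay (Γ (u, s)) * (y₁ s - y₀ s)) *
        (x₀' s + u * (x₁' s - x₀' s)) + a (Γ (u, s)) * (x₁' s - x₀' s) +
      ((ay (Γ (u, s)) * (x₁ s - x₀ s) + bY (Γ (u, s)) * (y₁ s - y₀ s)) *
        (y₀' s + u * (y₁' s - y₀' s)) + b (Γ (u, s)) * (y₁' s - y₀' s)) with hD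
  have cD : ContinuousOn D.uncurry (Icc (0 : ℝ) 1 ×ˢ Icc (0 : ℝ) 1) := by
    have h1 := compc ca
    have h2 := compc cb
    have h3 := compc hax
    have h4 := compc hay
    have h5 := compc hbY
    have e : D.uncurry = fun q : ℝ × ℝ =>
      (ax (Γ q) * (x₁ q.2 - x₀ q.2) + ay (Γ q) * (y₁ q.2 - y₀ q.2)) *
        (x₀' q.2 + q.1 * (x₁' q.2 - x₀' q.2)) + a (Γ q) * (x₁' q.2 - x₀' q.2) +
      ((ay (Γ q) * (x₁ q.2 - x₀ q.2) + bY (Γ q) * (y₁ q.2 - y₀ q.2)) *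
        (y₀' q.2 + q.1 * (y₁' q.2 - y₀' q.2)) + b (Γ q) * (y₁' q.2 - y₀' q.2)) := rfl
    rw [e]
    clear_value Γ
    fun_prop
  have along : ∀ {f : ℂ × ℂ → ℂ} {fx fy : ℂ} {g h : ℝ → ℂ} {g' h' : ℂ} {r : ℝ},
      HasFDerivAt f (fx • ContinuousLinearMap.fst ℂ ℂ ℂ + fy • ContinuousLinearMap.snd ℂ ℂ ℂ)
        (g r, h r) → HasDerivAt g g' r → HasDerivAt h h' r →
      HasDerivAt (fun r => f (g r, h r)) (fx * g' + fy * h') r := by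
    intro f fx fy g h g' h' r hf hg hh
    simpa [Function.comp_def] using (hf.restrictScalars ℝ).comp_hasDerivAt r (hg.prodMk hh)
  have key : ∀ s ∈ Icc (0 : ℝ) 1, ∫ u in (0 : ℝ)..1, D u s =
      (a (x₁ s, y₁ s) * x₁' s + b (x₁ s, y₁ s) * y₁' s) -
        (a (x₀ s, y₀ s) * x₀' s + b (x₀ s, y₀ s) * y₀' s) := by
    intro s hs
    have hder : ∀ u ∈ uIcc (0 : ℝ) 1, HasDerivAt (fun u : ℝ =>
        a (Γ (u, s)) * (x₀' s + u * (x₁' s - x₀' s)) +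
          b (Γ (u, s)) * (y₀' s + u * (y₁' s - y₀' s))) (D u s) u := by
      intro u hu
      rw [uIcc_of_le zero_le_one] at hu
      have lin : ∀ v w : ℂ, HasDerivAt (fun u : ℝ => v + u * w) w u := fun v w => by
        simpa using ((Complex.ofRealCLM.hasDerivAt (x := u)).mul_const w).const_add v
      have h1 := along (ha _ (hmem u hu s hs)) (lin (x₀ s) (x₁ s - x₀ s)) (lin (y₀ s) (y₁ s - y₀ s))
      have h2 := along (hb _ (hmem u hu s hs)) (lin (x₀ s) (x₁ s - x₀ s)) (lin (y₀ s) (y₁ s - y₀ s))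
      exact (h1.mul (lin _ _)).add (h2.mul (lin _ _))
    rw [intervalIntegral.integral_eq_sub_of_hasDerivAt hder]
    · simp [hΓ]
    · apply ContinuousOn.intervalIntegrable
      rw [uIcc_of_le zero_le_one]
      exact cD.comp (f := fun u => (u, s)) (by fun_prop) fun u hu => ⟨hu, hs⟩
  have key' : ∀ u ∈ Icc (0 : ℝ) 1, ∫ s in (0 : ℝ)..1, D u s = 0 := by
    intro u hu
    have hder : ∀ s ∈ uIcc (0 : ℝ) 1, HasDerivAt (fun s : ℝ =>
        a (Γ (u, s)) * (x₁ s - x₀ s) + b (Γ (u, s)) * (y₁ s - y₀ s)) (D u s) s := by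
      intro s hs
      rw [uIcc_of_le zero_le_one] at hs
      have hX : HasDerivAt (fun s => x₀ s + u * (x₁ s - x₀ s)) (x₀' s + u * (x₁' s - x₀' s)) s :=
        (hx₀ s).add (((hx₁ s).sub (hx₀ s)).const_mul (u : ℂ))
      have hY : HasDerivAt (fun s => y₀ s + u * (y₁ s - y₀ s)) (y₀' s + u * (y₁' s - y₀' s)) s :=
        (hy₀ s).add (((hy₁ s).sub (hy₀ s)).const_mul (u : ℂ))
      have h1 := along (ha _ (hmem u hu s hs)) hX hY
      have h2 := along (hb _ (hmem u hu s hs)) hX hY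
      refine ((h1.mul ((hx₁ s).sub (hx₀ s))).add (h2.mul ((hy₁ s).sub (hy₀ s)))).congr_deriv ?_
      simp only [hD, hΓ, Pi.sub_apply]
      ring
    rw [intervalIntegral.integral_eq_sub_of_hasDerivAt hder]
    · simp [hΓ, px₀, px₁, py₀, py₁]
    · apply ContinuousOn.intervalIntegrable
      rw [uIcc_of_le zero_le_one]
      exact cD.comp (f := fun s => (u, s)) (by fun_prop) fun s hs => ⟨hu, hs⟩
  have cform : ∀ u : ℝ, u ∈ Icc (0 : ℝ) 1 → ∀ {x' y' : ℝ → ℂ}, Continuous x' → Continuous y' →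
      IntervalIntegrable (fun s => a (Γ (u, s)) * x' s + b (Γ (u, s)) * y' s) volume 0 1 := by
    intro u hu x' y' hx' hy'
    apply ContinuousOn.intervalIntegrable
    rw [uIcc_of_le zero_le_one]
    have m : MapsTo (fun s : ℝ => (u, s)) (Icc 0 1) (Icc 0 1 ×ˢ Icc 0 1) := fun s hs => ⟨hu, hs⟩
    have h1 := (compc ca).comp (f := fun s => (u, s)) (by fun_prop) m
    have h2 := (compc cb).comp (f := fun s => (u, s)) (by fun_prop) m
    exact (h1.mul hx'.continuousOn).add (h2.mul hy'.continuousOn)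
  have swap := intervalIntegral_intervalIntegral_swap (F := D) (a := 0) (b := 1) (c := 0) (d := 1)
    (by
      rw [uIoc_of_le zero_le_one]
      exact (cD.integrableOn_compact (isCompact_Icc.prod isCompact_Icc)).mono_set
        (prod_mono Ioc_subset_Icc_self Ioc_subset_Icc_self))
  rw [intervalIntegral.integral_congr (g := fun _ => (0 : ℂ)) (fun u hu => key' u (by
      rwa [uIcc_of_le zero_le_one] at hu)), intervalIntegral.integral_congr (g := fun s =>
      (a (x₁ s, y₁ s) * x₁' s + b (x₁ s, y₁ s) * y₁' s) -
        (a (x₀ s, y₀ s) * x₀' s + b (x₀ s, y₀ s) * y₀' s)) (fun s hs => key s (by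
      rwa [uIcc_of_le zero_le_one] at hs)), intervalIntegral.integral_sub] at swap
  · rw [intervalIntegral.integral_zero] at swap
    exact (sub_eq_zero.1 swap.symm).symm
  · simpa [hΓ] using cform 1 (by simp) cx₁ cy₁
  · simpa [hΓ] using cform 0 (by simp) cx₀ cy₀

end ClosedForms

section FlatForms
open MeasureTheory Set Polynomial Metric

theorem Polynomial.hasFDerivAt_eval_fst (f : ℂ[X]) (z : ℂ × ℂ) :
    HasFDerivAt (fun z : ℂ × ℂ => f.eval z.1)
      ((derivative f).eval z.1 • ContinuousLinearMap.fst ℂ ℂ ℂ) z :=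
  (f.hasDerivAt z.1).comp_hasFDerivAt z hasFDerivAt_fst

theorem Polynomial.hasFDerivAt_sq_snd_sub_eval_fst (p : ℂ[X]) (z : ℂ × ℂ) :
    HasFDerivAt (fun z : ℂ × ℂ => z.2 ^ 2 - p.eval z.1)
      ((2 * z.2) • ContinuousLinearMap.snd ℂ ℂ ℂ -
        (derivative p).eval z.1 • ContinuousLinearMap.fst ℂ ℂ ℂ) z := by
  refine HasFDerivAt.sub ?_ (p.hasFDerivAt_eval_fst z)
  simpa [Function.comp_def] using (hasDerivAt_pow 2 z.2).comp_hasFDerivAt z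
    (hasFDerivAt_snd (𝕜 := ℂ))

/-- The form `y ^ j φ(H) e dx`-coefficient `y ^ j * (φ(H) * e(x))` and its partial derivatives. -/
theorem hasFDerivAt_pow_mul_comp_hamiltonian (p e : ℂ[X]) {φ : ℂ → ℂ} {φ' : ℂ} {z : ℂ × ℂ} (j : ℕ)
    (hφ : HasDerivAt φ φ' (z.2 ^ 2 - p.eval z.1)) :
    HasFDerivAt (fun z : ℂ × ℂ => z.2 ^ (j + 1) * (φ (z.2 ^ 2 - p.eval z.1) * e.eval z.1))
      ((z.2 ^ (j + 1) * (φ (z.2 ^ 2 - p.eval z.1) * (derivative e).eval z.1 -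
          φ' * (derivative p).eval z.1 * e.eval z.1)) • ContinuousLinearMap.fst ℂ ℂ ℂ +
        ((j + 1) * z.2 ^ j * (φ (z.2 ^ 2 - p.eval z.1) * e.eval z.1) +
          2 * z.2 ^ (j + 2) * φ' * e.eval z.1) • ContinuousLinearMap.snd ℂ ℂ ℂ) z := by
  have h1 := hφ.comp_hasFDerivAt z (p.hasFDerivAt_sq_snd_sub_eval_fst z)
  have h2 := (hasDerivAt_pow (j + 1) z.2).comp_hasFDerivAt z (hasFDerivAt_snd (𝕜 := ℂ))
  refine (h2.mul (h1.mul (e.hasFDerivAt_eval_fst z))).congr_fderiv ?_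
  ext
  · simp
    ring
  · simp
    ring

theorem sum_flat_mul_integral_eq {n : ℕ} {p : ℂ[X]} {e q : Fin n → ℂ[X]} {c : Fin n → Fin n → ℂ}
    {T : Fin n → ℂ} (he : ∀ k, e k * (p + C (T k)) = q k * derivative p)
    (hq : ∀ k, C (1 / 2) * e k + derivative (q k) = ∑ l, C (c k l) * e l)
    {t₁ : ℂ} {r : ℝ} {φ φ' : Fin n → ℂ → ℂ}
    (hφ : ∀ l, ∀ t ∈ ball t₁ r, HasDerivAt (φ l) (φ' l t) t ∧
      (t - T l) * φ' l t + φ l t + ∑ k, φ k t * c k l = 0)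
    {x₀ y₀ x₁ y₁ x₀' y₀' x₁' y₁' : ℝ → ℂ}
    (hx₀ : ∀ s, HasDerivAt x₀ (x₀' s) s) (hy₀ : ∀ s, HasDerivAt y₀ (y₀' s) s)
    (hx₁ : ∀ s, HasDerivAt x₁ (x₁' s) s) (hy₁ : ∀ s, HasDerivAt y₁ (y₁' s) s)
    (cx₀ : Continuous x₀') (cy₀ : Continuous y₀') (cx₁ : Continuous x₁') (cy₁ : Continuous y₁')
    (px₀ : x₀ 1 = x₀ 0) (py₀ : y₀ 1 = y₀ 0) (px₁ : x₁ 1 = x₁ 0) (py₁ : y₁ 1 = y₁ 0)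
    {τ₀ τ₁ : ℂ} (hf₀ : ∀ s, y₀ s ^ 2 - p.eval (x₀ s) = τ₀)
    (hf₁ : ∀ s, y₁ s ^ 2 - p.eval (x₁ s) = τ₁)
    (hmem : ∀ u ∈ Icc (0 : ℝ) 1, ∀ s ∈ Icc (0 : ℝ) 1,
      (y₀ s + u * (y₁ s - y₀ s)) ^ 2 - p.eval (x₀ s + u * (x₁ s - x₀ s)) ∈ ball t₁ r) :
    ∑ k, φ k τ₀ * (τ₀ - T k) * ∫ s in (0 : ℝ)..1, (e k).eval (x₀ s) * y₀ s * x₀' s =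
      ∑ k, φ k τ₁ * (τ₁ - T k) * ∫ s in (0 : ℝ)..1, (e k).eval (x₁ s) * y₁ s * x₁' s := by
  set H : ℂ × ℂ → ℂ := fun z => z.2 ^ 2 - p.eval z.1 with hH
  have cH : Continuous H := by fun_prop
  set W : Set (ℂ × ℂ) := H ⁻¹' ball t₁ r
  set a : ℂ × ℂ → ℂ := fun z => ∑ k, z.2 ^ (2 + 1) * (φ k (H z) * (e k).eval z.1)
  set b : ℂ × ℂ → ℂ := fun z => -2 * ∑ k, z.2 ^ (1 + 1) * (φ k (H z) * (q k).eval z.1)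
  have hpoint : ∀ k x y, y ^ 2 * (e k).eval x - (q k).eval x * (derivative p).eval x =
      (H (x, y) - T k) * (e k).eval x := by
    intro k x y
    have := congrArg (Polynomial.eval x) (he k)
    simp only [eval_mul, eval_add, eval_C] at this
    simp only [hH]
    linear_combination this
  have cφ : ∀ k, ContinuousOn (φ k) (ball t₁ r) := fun k t ht =>
    (hφ k t ht).1.continuousAt.continuousWithinAt
  have cφ' : ∀ k, ContinuousOn (φ' k) (ball t₁ r) := by
    intro k
    have hd : DifferentiableOn ℂ (φ k) (ball t₁ r) := fun t ht =>
      (hφ k t ht).1.differentiableAt.differentiableWithinAt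
    exact (hd.deriv isOpen_ball).continuousOn.congr fun t ht => (hφ k t ht).1.deriv.symm
  have cφH : ∀ k, ContinuousOn (fun z => φ k (H z)) W := fun k =>
    (cφ k).comp cH.continuousOn fun z hz => hz
  have cφH' : ∀ k, ContinuousOn (fun z => φ' k (H z)) W := fun k =>
    (cφ' k).comp cH.continuousOn fun z hz => hz
  set ax : ℂ × ℂ → ℂ := fun z => ∑ k, z.2 ^ (2 + 1) * (φ k (H z) * (derivative (e k)).eval z.1 -
    φ' k (H z) * (derivative p).eval z.1 * (e k).eval z.1)
  set ay : ℂ × ℂ → ℂ := fun z => ∑ k, (((2 : ℕ) + 1) * z.2 ^ 2 * (φ k (H z) * (e k).eval z.1) +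
    2 * z.2 ^ (2 + 2) * φ' k (H z) * (e k).eval z.1) with hay
  set bX : ℂ × ℂ → ℂ := fun z => -2 * ∑ k, z.2 ^ (1 + 1) * (φ k (H z) *
    (derivative (q k)).eval z.1 - φ' k (H z) * (derivative p).eval z.1 * (q k).eval z.1) with hbX
  set bY : ℂ × ℂ → ℂ := fun z => -2 * ∑ k, (((1 : ℕ) + 1) * z.2 ^ 1 * (φ k (H z) *
    (q k).eval z.1) + 2 * z.2 ^ (1 + 2) * φ' k (H z) * (q k).eval z.1)
  have ha : ∀ z ∈ W, HasFDerivAt a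
      (ax z • ContinuousLinearMap.fst ℂ ℂ ℂ + ay z • ContinuousLinearMap.snd ℂ ℂ ℂ) z := by
    intro z hz
    have := HasFDerivAt.fun_sum (u := Finset.univ) fun k _ =>
      hasFDerivAt_pow_mul_comp_hamiltonian p (e k) 2 (hφ k _ hz).1
    rw [Finset.sum_add_distrib, ← Finset.sum_smul, ← Finset.sum_smul] at this
    exact this
  have hb : ∀ z ∈ W, HasFDerivAt b
      (bX z • ContinuousLinearMap.fst ℂ ℂ ℂ + bY z • ContinuousLinearMap.snd ℂ ℂ ℂ) z := by
    intro z hz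
    have := (HasFDerivAt.fun_sum (u := Finset.univ) fun k _ =>
      hasFDerivAt_pow_mul_comp_hamiltonian p (q k) 1 (hφ k _ hz).1).const_mul (-2)
    rw [Finset.sum_add_distrib, ← Finset.sum_smul, ← Finset.sum_smul, smul_add, smul_smul,
      smul_smul] at this
    exact this
  have hclosed : ∀ z ∈ W, bX z = ay z := by
    intro z hz
    have h1 : ∑ k, (H z - T k) * φ' k (H z) * (e k).eval z.1 =
        -∑ k, φ k (H z) * (e k).eval z.1 -
          ∑ k, φ k (H z) * (1 / 2 * (e k).eval z.1 + (derivative (q k)).eval z.1) := by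
      have h2 : ∀ k, 1 / 2 * (e k).eval z.1 + (derivative (q k)).eval z.1 =
          ∑ l, c k l * (e l).eval z.1 := by
        intro k
        have := congrArg (Polynomial.eval z.1) (hq k)
        simpa only [eval_mul, eval_add, eval_C, eval_finsetSum] using this
      simp only [h2, Finset.mul_sum]
      rw [Finset.sum_comm (f := fun k l => φ k (H z) * (c k l * (e l).eval z.1)),
        ← Finset.sum_neg_distrib, ← Finset.sum_sub_distrib]
      refine Finset.sum_congr rfl fun k _ => ?_
      have h3 := (hφ k _ hz).2
      have h4 : ∑ i, φ i (H z) * (c i k * (e k).eval z.1) =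
          (∑ i, φ i (H z) * c i k) * (e k).eval z.1 := by
        rw [Finset.sum_mul]
        exact Finset.sum_congr rfl fun i _ => by ring
      rw [h4]
      linear_combination (e k).eval z.1 * h3
    have h5 : ay z - bX z = 2 * z.2 ^ 2 * (∑ k, (H z - T k) * φ' k (H z) * (e k).eval z.1 +
        ∑ k, φ k (H z) * (e k).eval z.1 +
          ∑ k, φ k (H z) * (1 / 2 * (e k).eval z.1 + (derivative (q k)).eval z.1)) := by
      simp only [hay, hbX]
      rw [← Finset.sum_add_distrib, ← Finset.sum_add_distrib, Finset.mul_sum, Finset.mul_sum,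
        ← Finset.sum_sub_distrib]
      refine Finset.sum_congr rfl fun k _ => ?_
      push_cast
      linear_combination 2 * z.2 ^ 2 * φ' k (H z) * hpoint k z.1 z.2
    rw [h1] at h5
    linear_combination -h5
  have cpoly : ∀ f : ℂ[X], ContinuousOn (fun z : ℂ × ℂ => f.eval z.1) W := fun f => by fun_prop
  have cpow : ∀ (m : ℂ) (j : ℕ), ContinuousOn (fun z : ℂ × ℂ => m * z.2 ^ j) W :=
    fun m j => by fun_prop
  have cax : ContinuousOn ax W := continuousOn_finsetSum _ fun k _ =>
    (by fun_prop : ContinuousOn (fun z : ℂ × ℂ => z.2 ^ (2 + 1)) W).mul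
      (((cφH k).mul (cpoly _)).sub (((cφH' k).mul (cpoly _)).mul (cpoly _)))
  have cay : ContinuousOn ay W := continuousOn_finsetSum _ fun k _ =>
    ((cpow _ _).mul ((cφH k).mul (cpoly _))).add (((cpow _ _).mul (cφH' k)).mul (cpoly _))
  have cbY : ContinuousOn bY W := continuousOn_const.mul (continuousOn_finsetSum _ fun k _ =>
    ((cpow _ _).mul ((cφH k).mul (cpoly _))).add (((cpow _ _).mul (cφH' k)).mul (cpoly _)))
  have hmain := integral_closedForm_eq_of_segment_mem (W := W) ha
    (fun z hz => hclosed z hz ▸ hb z hz)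
    cax cay cbY hx₀ hy₀ hx₁ hy₁ cx₀ cy₀ cx₁ cy₁ px₀ py₀ px₁ py₁ hmem
  have hloop : ∀ {x y x' y' : ℝ → ℂ} {τ : ℂ}, (∀ s, HasDerivAt x (x' s) s) →
      (∀ s, HasDerivAt y (y' s) s) → Continuous x' → (∀ s, y s ^ 2 - p.eval (x s) = τ) →
      ∫ s in (0 : ℝ)..1, (a (x s, y s) * x' s + b (x s, y s) * y' s) =
        ∑ k, φ k τ * (τ - T k) * ∫ s in (0 : ℝ)..1, (e k).eval (x s) * y s * x' s := by
    intro x y x' y' τ hx hy cx' hf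
    have cx : Continuous x := continuous_iff_continuousAt.2 fun s => (hx s).continuousAt
    have cy : Continuous y := continuous_iff_continuousAt.2 fun s => (hy s).continuousAt
    simp only [← intervalIntegral.integral_const_mul]
    rw [← intervalIntegral.integral_finsetSum]
    · refine intervalIntegral.integral_congr fun s _ => ?_
      have hd : 2 * y s * y' s = (derivative p).eval (x s) * x' s := by
        have h1 := ((hy s).pow 2).sub (HasDerivAt.comp_of_eq s (p.hasDerivAt (x s)) (hx s) rfl)
        have h2 : (y ^ 2 - (fun x => p.eval x) ∘ x) = fun _ => τ := funext hf
        rw [h2] at h1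
        have := h1.unique (hasDerivAt_const s τ)
        simp at this
        linear_combination this
      have hHs : H (x s, y s) = τ := hf s
      simp only [a, b, hHs, Finset.mul_sum, Finset.sum_mul]
      rw [← Finset.sum_add_distrib]
      refine Finset.sum_congr rfl fun k _ => ?_
      have := hpoint k (x s) (y s)
      rw [hHs] at this
      linear_combination φ k τ * y s * x' s * this - y s * φ k τ * (q k).eval (x s) * hd
    · intro k _
      apply Continuous.intervalIntegrable
      fun_prop
  rw [← hloop hx₀ hy₀ cx₀ hf₀, ← hloop hx₁ hy₁ cx₁ hf₁, hmain]

end FlatForms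

section PicardFuchs
open MeasureTheory Set Filter Topology Polynomial Metric

theorem Matrix.differentiableAt_det {n : Type*} [Fintype n] [DecidableEq n]
    {M : ℂ → Matrix n n ℂ} {t : ℂ} (hM : ∀ i j, DifferentiableAt ℂ (fun s => M s i j) t) :
    DifferentiableAt ℂ (fun s => (M s).det) t := by
  simp only [Matrix.det_apply]
  fun_prop

/-- A vector function satisfying `Φ w = v` with `Φ` differentiable and invertible
is differentiable. -/
theorem differentiableAt_of_eventually_mulVec_eq {n : Type*} [Fintype n] [DecidableEq n]
    {Φ : ℂ → Matrix n n ℂ} {w : ℂ → n → ℂ} {v : n → ℂ} {t : ℂ}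
    (hΦ : ∀ i j, DifferentiableAt ℂ (fun s => Φ s i j) t) (hdet : (Φ t).det ≠ 0)
    (hw : ∀ᶠ s in 𝓝 t, (Φ s).mulVec (w s) = v) (k : n) :
    DifferentiableAt ℂ (fun s => w s k) t := by
  have hd := Matrix.differentiableAt_det hΦ
  have hadj : ∀ j, DifferentiableAt ℂ (fun s => (Φ s).adjugate k j) t := by
    intro j
    simp only [Matrix.adjugate_apply]
    refine Matrix.differentiableAt_det fun i l => ?_
    by_cases h : i = j
    · subst h
      simp
    · simpa [Matrix.updateRow_ne h] using hΦ i l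
  have heq : (fun s => w s k) =ᶠ[𝓝 t] fun s => (Φ s).det⁻¹ * ∑ j, (Φ s).adjugate k j * v j := by
    filter_upwards [hw, hd.continuousAt.eventually_ne hdet] with s hs hs'
    have h1 := congrArg ((Φ s).adjugate.mulVec) hs
    rw [Matrix.mulVec_mulVec, Matrix.adjugate_mul, Matrix.smul_mulVec, Matrix.one_mulVec] at h1
    have h2 := congrFun h1 k
    simp only [Pi.smul_apply, smul_eq_mul] at h2
    change _ = _ * (Φ s).adjugate.mulVec v k
    rw [← h2, inv_mul_cancel_left₀ hs']
  refine DifferentiableAt.congr_of_eventuallyEq ?_ heq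
  fun_prop (disch := exact hdet)

theorem hasDerivAt_abelianIntegral {n : ℕ} {p : ℂ[X]} {e q : Fin n → ℂ[X]}
    {c : Fin n → Fin n → ℂ} {T : Fin n → ℂ} (he : ∀ k, e k * (p + C (T k)) = q k * derivative p)
    (hq : ∀ k, C (1 / 2) * e k + derivative (q k) = ∑ l, C (c k l) * e l)
    {U : Set ℂ} (hU : IsOpen U) (hreg : ∀ t ∈ U, ∀ k, t ≠ T k) {δx δy δx' δy' : ℂ → ℝ → ℂ}
    (hcont : ContinuousOn (fun q : ℂ × ℝ => (δx q.1 q.2, δy q.1 q.2)) (U ×ˢ Set.univ))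
    (hper : ∀ t ∈ U, ∀ s : ℝ, δx t (s + 1) = δx t s ∧ δy t (s + 1) = δy t s)
    (hdx : ∀ t ∈ U, ∀ s : ℝ, HasDerivAt (δx t) (δx' t s) s)
    (hdy : ∀ t ∈ U, ∀ s : ℝ, HasDerivAt (δy t) (δy' t s) s)
    (hcont' : ContinuousOn (fun q : ℂ × ℝ => (δx' q.1 q.2, δy' q.1 q.2)) (U ×ˢ Set.univ))
    (hfib : ∀ t ∈ U, ∀ s : ℝ, δy t s ^ 2 - p.eval (δx t s) = t)
    {J : Fin n → ℂ → ℂ}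
    (hJ : ∀ k t, J k t = ∫ s in (0 : ℝ)..1, (e k).eval (δx t s) * δy t s * δx' t s)
    {t₁ : ℂ} (ht₁ : t₁ ∈ U) (i : Fin n) :
    DifferentiableAt ℂ (J i) t₁ ∧ (t₁ - T i) * deriv (J i) t₁ = ∑ k, c i k * J k t₁ := by
  have hne : ∀ k, t₁ - T k ≠ 0 := fun k => sub_ne_zero.2 (hreg t₁ ht₁ k)
  choose r hr φ φ' hφ₁ hφ using fun i : Fin n =>
    exists_flat_section c (hreg t₁ ht₁) (Pi.single i 1)
  have hat : ∀ t ∈ U, ∀ s : ℝ, ContinuousAt (fun q : ℂ × ℝ => (δx q.1 q.2, δy q.1 q.2)) (t, s) :=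
    fun t ht s => hcont.continuousAt ((hU.prod isOpen_univ).mem_nhds ⟨ht, mem_univ s⟩)
  have hderc : ∀ t ∈ U, Continuous (fun s => (δx' t s, δy' t s)) := fun t ht =>
    continuousOn_univ.1 (hcont'.comp (f := fun s : ℝ => (t, s)) (by fun_prop)
      fun s _ => ⟨ht, mem_univ s⟩)
  have hper' : ∀ t ∈ U, δx t 1 = δx t 0 ∧ δy t 1 = δy t 0 := fun t ht => by
    simpa using hper t ht 0
  have hnear : ∀ i, ∀ᶠ t in 𝓝 t₁, ∀ us ∈ Icc (0 : ℝ) 1 ×ˢ Icc (0 : ℝ) 1,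
      (δy t₁ us.2 + us.1 * (δy t us.2 - δy t₁ us.2)) ^ 2 -
        p.eval (δx t₁ us.2 + us.1 * (δx t us.2 - δx t₁ us.2)) ∈ ball t₁ (r i) := by
    intro i
    refine (isCompact_Icc.prod isCompact_Icc).eventually_forall_of_forall_eventually
      fun us _ => ?_
    have h1 : ContinuousAt (fun z : ℂ × ℝ × ℝ => (δx z.1 z.2.2, δy z.1 z.2.2)) (t₁, us) :=
      ContinuousAt.comp (x := (t₁, us)) (f := fun z => (z.1, z.2.2)) (hat t₁ ht₁ us.2) (by fun_prop)
    have h2 : ContinuousAt (fun z : ℂ × ℝ × ℝ => (δx t₁ z.2.2, δy t₁ z.2.2)) (t₁, us) :=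
      ContinuousAt.comp (x := (t₁, us)) (f := fun z => (t₁, z.2.2)) (hat t₁ ht₁ us.2) (by fun_prop)
    have h1x := h1.fst
    have h1y := h1.snd
    have h2x := h2.fst
    have h2y := h2.snd
    have h3 : ContinuousAt (fun z : ℂ × ℝ × ℝ =>
        (δy t₁ z.2.2 + z.2.1 * (δy z.1 z.2.2 - δy t₁ z.2.2)) ^ 2 -
          p.eval (δx t₁ z.2.2 + z.2.1 * (δx z.1 z.2.2 - δx t₁ z.2.2))) (t₁, us) := by
      have hu : ContinuousAt (fun z : ℂ × ℝ × ℝ => (z.2.1 : ℂ)) (t₁, us) := by fun_prop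
      exact ((h2y.add (hu.mul (h1y.sub h2y))).pow 2).sub
        (ContinuousAt.comp (g := fun x => p.eval x) p.continuous.continuousAt
          (h2x.add (hu.mul (h1x.sub h2x))))
    refine h3.eventually_mem (isOpen_ball.mem_nhds ?_)
    simpa [hfib t₁ ht₁] using hr i
  have hconst : ∀ i, ∀ᶠ t in 𝓝 t₁,
      ∑ k, φ i k t * ((t - T k) * J k t) = (t₁ - T i) * J i t₁ := by
    intro i
    filter_upwards [hnear i, hU.mem_nhds ht₁] with t ht htU
    have := sum_flat_mul_integral_eq he hq (hφ i) (hdx t₁ ht₁) (hdy t₁ ht₁) (hdx t htU)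
      (hdy t htU) (hderc t₁ ht₁).fst (hderc t₁ ht₁).snd (hderc t htU).fst (hderc t htU).snd
      (hper' t₁ ht₁).1 (hper' t₁ ht₁).2 (hper' t htU).1 (hper' t htU).2 (hfib t₁ ht₁)
      (hfib t htU) (fun u hu s hs => ht (u, s) ⟨hu, hs⟩)
    simp only [← hJ, hφ₁] at this
    simpa [Pi.single_apply, mul_assoc] using this.symm
  have hball : ∀ i, t₁ ∈ ball t₁ (r i) := fun i => mem_ball_self (hr i)
  have hwd := differentiableAt_of_eventually_mulVec_eq (t := t₁)
    (Φ := fun t => Matrix.of fun i k => φ i k t) (w := fun t k => (t - T k) * J k t)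
    (v := fun i => (t₁ - T i) * J i t₁)
    (fun i k => (hφ i k t₁ (hball i)).1.differentiableAt)
    (by
      have : (Matrix.of fun i k => φ i k t₁) = (1 : Matrix (Fin n) (Fin n) ℂ) := by
        ext i k
        simp [hφ₁, Matrix.one_apply, Pi.single_apply, eq_comm]
      simp [this])
    (by
      filter_upwards [eventually_all.2 hconst] with t ht
      exact funext ht)
  have hJd : ∀ k, DifferentiableAt ℂ (J k) t₁ := by
    intro k
    have h1 : J k =ᶠ[𝓝 t₁] fun t => (t - T k) * J k t / (t - T k) := by
      filter_upwards [hU.mem_nhds ht₁] with t ht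
      rw [mul_div_cancel_left₀ _ (sub_ne_zero.2 (hreg t ht k))]
    exact ((hwd k).div (by fun_prop) (hne k)).congr_of_eventuallyEq h1
  refine ⟨hJd i, ?_⟩
  have h1 : HasDerivAt (fun t => ∑ k, φ i k t * ((t - T k) * J k t))
      (∑ k, (φ' i k t₁ * ((t₁ - T k) * J k t₁) +
        φ i k t₁ * (1 * J k t₁ + (t₁ - T k) * deriv (J k) t₁))) t₁ :=
    HasDerivAt.fun_sum fun k _ => (hφ i k t₁ (hball i)).1.mul
      (((hasDerivAt_id t₁).sub_const (T k)).mul (hJd k).hasDerivAt)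
  have h2 := h1.unique ((hasDerivAt_const t₁ _).congr_of_eventuallyEq (hconst i))
  have h3 : ∀ k, φ' i k t₁ * ((t₁ - T k) * J k t₁) =
      -((Pi.single i 1 : Fin n → ℂ) k + c i k) * J k t₁ := by
    intro k
    have := (hφ i k t₁ (hball i)).2
    simp only [hφ₁, Pi.single_apply, ite_mul, one_mul, zero_mul, Finset.sum_ite_eq',
      Finset.mem_univ, if_true] at this ⊢
    linear_combination J k t₁ * this
  simp only [h3, hφ₁, Finset.sum_add_distrib, add_mul, neg_mul, Finset.sum_neg_distrib,
    Pi.single_apply, ite_mul, one_mul, zero_mul, Finset.sum_ite_eq', Finset.mem_univ, if_true,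
    neg_add] at h2
  linear_combination h2

end PicardFuchs

section Order
open Filter Topology

theorem ordAt_le_of_analyticOrderAt_le {f : ℂ → ℂ} {t₀ : ℂ} {N : ℕ} (hf : AnalyticAt ℂ f t₀)
    (h : analyticOrderAt f t₀ ≤ N) : ordAt f t₀ ≤ N := by
  obtain ⟨k, hk⟩ := ENat.ne_top_iff_exists.1 (ne_top_of_le_ne_top (ENat.natCast_ne_top N) h)
  have hkN : k ≤ N := by
    rw [← hk] at h
    exact_mod_cast h
  exact (Nat.sInf_le ((analyticOrderAt_eq_nat_iff_iteratedDeriv_eq_zero hf).1 hk.symm).2).trans hkN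

/-- Functions on an open set solving `(t - T k) J k' = ∑ c k l J l` are analytic, and their
derivatives solve the Okubo system with residues `c - 1`. -/
theorem analyticAt_and_okubo_deriv {n : ℕ} {T : Fin n → ℂ} {c : Fin n → Fin n → ℂ} {U : Set ℂ}
    (hU : IsOpen U) {J : Fin n → ℂ → ℂ}
    (hJ : ∀ t ∈ U, ∀ k, DifferentiableAt ℂ (J k) t ∧
      (t - T k) * deriv (J k) t = ∑ l, c k l * J l t) {t₀ : ℂ} (ht₀ : t₀ ∈ U) (k : Fin n) :
    AnalyticAt ℂ (J k) t₀ ∧ (t₀ - T k) * deriv (deriv (J k)) t₀ =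
      ∑ l, (c k l - if k = l then 1 else 0) * deriv (J l) t₀ := by
  have han : AnalyticAt ℂ (J k) t₀ := DifferentiableOn.analyticAt
    (fun t ht => (hJ t ht k).1.differentiableWithinAt) (hU.mem_nhds ht₀)
  refine ⟨han, ?_⟩
  have h1 : HasDerivAt (fun t => (t - T k) * deriv (J k) t)
      (1 * deriv (J k) t₀ + (t₀ - T k) * deriv (deriv (J k)) t₀) t₀ :=
    ((hasDerivAt_id t₀).sub_const (T k)).mul han.deriv.differentiableAt.hasDerivAt
  have h2 : HasDerivAt (fun t => ∑ l, c k l * J l t) (∑ l, c k l * deriv (J l) t₀) t₀ :=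
    HasDerivAt.fun_sum fun l _ => (hJ t₀ ht₀ l).1.hasDerivAt.const_mul (c k l)
  have h3 := h1.unique (h2.congr_of_eventuallyEq (by
    filter_upwards [hU.mem_nhds ht₀] with t ht using (hJ t ht k).2))
  simp only [sub_mul, Finset.sum_sub_distrib, ite_mul, one_mul, zero_mul, Finset.sum_ite_eq,
    Finset.mem_univ, if_true]
  linear_combination h3

end Order

/-- for a Morse-type hyperelliptic polynomial `H = y² − x^{n+1} + H̄(x)`,
a nonzero combination `ω = ∑ cᵢ ωᵢ` of the Petrov forms `ωᵢ = x^{i−1}y dx`, and a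
continuous family `δ(t)` of loops in the fibres `{H = t}` over a neighbourhood of a
regular value `t₀`, the Abelian integral `I(t) = ∮_{δ(t)} ω` is analytic near `t₀`, and
if `I ≢ 0` then `ord_{t₀} I ≤ n − 1 + n(n−1)/2`. -/
theorem ord_abelian_integral_le
    (n : ℕ) (hn : 2 ≤ n)
    (Hbar : Polynomial ℂ) (hHdeg : Hbar.natDegree ≤ n - 1)
    -- Morse type: `p′ = (x^{n+1} − H̄)′` has `n` distinct roots, with distinct critical values
    (xs : Fin n → ℂ) (hxs : Function.Injective xs)
    (hroots : ∀ k, (Polynomial.derivative (Polynomial.X ^ (n + 1) - Hbar)).eval (xs k) = 0)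
    (hMorse : Function.Injective fun k => -((Polynomial.X ^ (n + 1) - Hbar).eval (xs k)))
    -- the coefficients of `ω = ∑ cᵢ ωᵢ`, not all zero
    (c : Fin n → ℂ) (hc : c ≠ 0)
    -- `t₀` a regular value, `U` an open connected neighbourhood of regular values
    (t₀ : ℂ) (U : Set ℂ) (hU : IsOpen U) (hUconn : IsConnected U) (ht₀U : t₀ ∈ U)
    (hreg : ∀ t ∈ U, ∀ k, t ≠ -((Polynomial.X ^ (n + 1) - Hbar).eval (xs k)))
    -- the family of loops `δ(t,s) = (δx(t,s), δy(t,s))` and its `s`-derivative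
    (δx δy δx' δy' : ℂ → ℝ → ℂ)
    (hcont : ContinuousOn (fun q : ℂ × ℝ => (δx q.1 q.2, δy q.1 q.2)) (U ×ˢ Set.univ))
    (hper : ∀ t ∈ U, ∀ s : ℝ, δx t (s + 1) = δx t s ∧ δy t (s + 1) = δy t s)
    (hdx : ∀ t ∈ U, ∀ s : ℝ, HasDerivAt (δx t) (δx' t s) s)
    (hdy : ∀ t ∈ U, ∀ s : ℝ, HasDerivAt (δy t) (δy' t s) s)
    (hcont' : ContinuousOn (fun q : ℂ × ℝ => (δx' q.1 q.2, δy' q.1 q.2)) (U ×ˢ Set.univ))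
    -- the loops lie in the fibres: `H(δ(t,s)) = t`
    (hfib : ∀ t ∈ U, ∀ s : ℝ,
      (δy t s) ^ 2 - (δx t s) ^ (n + 1) + Hbar.eval (δx t s) = t)
    -- the Abelian integral `I(t) = ∮_{δ(t)} (∑ᵢ cᵢ x^{i−1} y) dx`
    (I : ℂ → ℂ)
    (hI : ∀ t, I t = ∫ s in (0:ℝ)..1,
      (∑ i : Fin n, c i * (δx t s) ^ (i : ℕ)) * δy t s * δx' t s) :
    AnalyticAt ℂ I t₀ ∧
      ((¬ ∀ᶠ t in nhds t₀, I t = 0) → ordAt I t₀ ≤ n - 1 + n * (n - 1) / 2) := by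
  open Polynomial in
  set p : Polynomial ℂ := X ^ (n + 1) - Hbar with hp
  have hdeg : Hbar.degree < (n + 1 : ℕ) := Polynomial.degree_le_natDegree.trans_lt
    (by exact_mod_cast (by omega : Hbar.natDegree < n + 1))
  have hmonic : p.Monic := by
    rw [hp, sub_eq_add_neg]
    exact Polynomial.monic_X_pow_add (by rwa [Polynomial.degree_neg])
  have hpdeg : p.natDegree = n + 1 := by
    rw [hp, Polynomial.natDegree_sub_eq_left_of_natDegree_lt] <;>
      rw [Polynomial.natDegree_X_pow]
    omega
  obtain ⟨e, q, m, he, hq, hmd, hspan⟩ :=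
    exists_picardFuchs_relations (by omega) hmonic hpdeg hxs hroots
  obtain ⟨h, hh⟩ := hspan c
  set T : Fin n → ℂ := fun k => -(p.eval (xs k))
  set J : Fin n → ℂ → ℂ := fun k t =>
    ∫ s in (0 : ℝ)..1, (e k).eval (δx t s) * δy t s * δx' t s with hJ
  have hsys : ∀ t ∈ U, ∀ k, DifferentiableAt ℂ (J k) t ∧
      (t - T k) * deriv (J k) t = ∑ l, m k l * J l t := fun t ht k =>
    hasDerivAt_abelianIntegral (p := p) (fun k => by simp [← he k, sub_eq_add_neg]) hq hU hreg
      hcont hper hdx hdy hcont' (fun t ht s => by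
        simp only [hp, Polynomial.eval_sub, Polynomial.eval_pow, Polynomial.eval_X]
        linear_combination hfib t ht s)
      (fun _ _ => rfl) ht k
  have hIJ : ∀ t ∈ U, I t = ∑ k, ∑ l, h k * m k l * J l t := by
    intro t ht
    have hd : Continuous (fun s => (δx' t s, δy' t s)) := continuousOn_univ.1
      (hcont'.comp (f := fun s : ℝ => (t, s)) (by fun_prop) fun s _ => ⟨ht, Set.mem_univ s⟩)
    have hx : Continuous (δx t) := continuous_iff_continuousAt.2 fun s => (hdx t ht s).continuousAt
    have hy : Continuous (δy t) := continuous_iff_continuousAt.2 fun s => (hdy t ht s).continuousAt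
    have hx' := hd.fst
    have hint : ∀ (a : ℂ) (l : Fin n), IntervalIntegrable
        (fun s => a * ((e l).eval (δx t s) * δy t s * δx' t s)) MeasureTheory.volume 0 1 :=
      fun a l => Continuous.intervalIntegrable (by fun_prop) _ _
    simp only [hJ, ← intervalIntegral.integral_const_mul]
    rw [hI, Finset.sum_congr rfl fun k _ =>
      (intervalIntegral.integral_finsetSum fun l _ => hint (h k * m k l) l).symm,
      ← intervalIntegral.integral_finsetSum]
    · refine intervalIntegral.integral_congr fun s _ => ?_
      have := congrArg (Polynomial.eval (δx t s)) hh
      simp only [Polynomial.eval_finsetSum, Polynomial.eval_mul, Polynomial.eval_C,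
        Polynomial.eval_pow, Polynomial.eval_X] at this
      simp only [this, Finset.sum_mul, mul_assoc]
    · intro k _
      simpa [← Finset.sum_fn] using
        IntervalIntegrable.sum Finset.univ fun l _ => hint (h k * m k l) l
  have hok := fun t (ht : t ∈ U) k => analyticAt_and_okubo_deriv hU hsys ht k
  have hIJ' : I =ᶠ[nhds t₀] fun t => ∑ k, h k * (t - T k) * deriv (J k) t := by
    filter_upwards [hU.mem_nhds ht₀U] with t ht
    rw [hIJ t ht]
    refine Finset.sum_congr rfl fun k _ => ?_
    rw [mul_assoc, (hsys t ht k).2, Finset.mul_sum]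
    exact Finset.sum_congr rfl fun l _ => mul_assoc _ _ _
  have hderiv : ∀ k, AnalyticAt ℂ (deriv (J k)) t₀ := fun k => (hok t₀ ht₀U k).1.deriv
  have hI_an : AnalyticAt ℂ I t₀ := by
    refine AnalyticAt.congr (Finset.analyticAt_fun_sum _ fun k _ => ?_) hIJ'.symm
    exact (analyticAt_const.mul (analyticAt_id.sub analyticAt_const)).mul (hderiv k)
  refine ⟨hI_an, fun h0 => ordAt_le_of_analyticOrderAt_le hI_an ?_⟩
  exact analyticOrderAt_okubo_le (T := T) hMorse
    (B := fun k l => m k l - if k = l then 1 else 0) (fun k => by simp [hmd]) hn h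
    (fun k => hreg t₀ ht₀U k) hderiv
    (fun k => by filter_upwards [hU.mem_nhds ht₀U] with t ht using (hok t ht k).2) hIJ' h0
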